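/- arXiv:2407.18347 — 7 statements merged into one kernel-verified Lean document; each statement's English description precedes it below -/
import Mathlib

section
/- Let a ≥ 1 and N ≥ 2a+1, and let r_j (for -a ≤ j ≤ a) be the (2a+1)-point central finite-difference coefficients for the second derivative. Set λ = Σ_{j=-a}^{a} |r_j| and let L = Σ_{j=-a}^{a} r_j S^j be the N×N periodic finite-difference Laplacian, where S is the cyclic shift on ℂ^N. Then with q = ⌈log₂(2a+1)⌉ there exists a unitary matrix U on ℂ^{2^q} ⊗ ℂ^N such that (⟨0|^{⊗q} ⊗ I_N) U (|0⟩^{⊗q} ⊗ I_N) = L/λ; that is, L admits a (λ, q) block encoding. -/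
open Matrix

/-- The shift-by-`j` operator on `ℂ^N`: the permutation matrix sending `e_i` to
`e_{(i+j) mod N}`, so that it equals `S^j` for the cyclic shift `S`. -/
def shiftPow (N : ℕ) (j : ℤ) : Matrix (ZMod N) (ZMod N) ℂ :=
  Matrix.of fun m n => if m = n + (j : ZMod N) then 1 else 0

/-- The `(2a+1)`-point central finite-difference coefficient for the second derivative,
for indices `1 ≤ k ≤ a`. -/
noncomputable def fdCoeffPos (a k : ℕ) : ℝ :=
  2 * (-1 : ℝ) ^ (k + 1) * (Nat.factorial a : ℝ) ^ 2 /
    ((k : ℝ) ^ 2 * (Nat.factorial (a - k) : ℝ) * (Nat.factorial (a + k) : ℝ))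

/-- The `(2a+1)`-point central finite-difference coefficients for the second derivative:
`r_j = r_{-j}` for `1 ≤ j ≤ a`, and `r_0 = -2 Σ_{j=1}^a r_j`. -/
noncomputable def fdCoeff (a : ℕ) (j : ℤ) : ℝ :=
  if j = 0 then -2 * ∑ k ∈ Finset.Icc 1 a, fdCoeffPos a k
  else fdCoeffPos a j.natAbs

/-- Any unit vector is a column of some unitary matrix. -/
lemma exists_mem_unitaryGroup_col_eq {ι : Type*} [Fintype ι] [DecidableEq ι] (i₀ : ι)
    (v : ι → ℂ) (hv : ∑ k, ‖v k‖ ^ 2 = 1) :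
    ∃ V ∈ Matrix.unitaryGroup ι ℂ, ∀ k, V k i₀ = v k := by
  have hn : ‖WithLp.toLp 2 v‖ = 1 := by
    rw [EuclideanSpace.norm_eq, hv, Real.sqrt_one]
  have ho : Orthonormal ℂ
      (Set.domRestrict {i₀} fun _ : ι => (WithLp.toLp 2 v : EuclideanSpace ℂ ι)) :=
    ⟨fun _ => hn, fun i j hij => absurd (Subsingleton.elim i j) hij⟩
  obtain ⟨b, hb⟩ := ho.exists_orthonormalBasis_extension_of_card_eq (by simp)
  refine ⟨(EuclideanSpace.basisFun ι ℂ).toBasis.toMatrix b,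
    (EuclideanSpace.basisFun ι ℂ).toMatrix_orthonormalBasis_mem_unitary b, fun k => ?_⟩
  simp [Module.Basis.toMatrix_apply, hb i₀ rfl]

open scoped Kronecker in
/-- Linear combination of unitaries: a convex combination of unitary matrices is a corner block
of a unitary matrix. -/
lemma exists_mem_unitaryGroup_block_eq_sum {ι n : Type*} [Fintype ι] [DecidableEq ι]
    [Fintype n] [DecidableEq n] (i₀ : ι) (p : ι → ℝ) (hp : ∀ k, 0 ≤ p k) (hp1 : ∑ k, p k = 1)
    (W : ι → Matrix n n ℂ) (hW : ∀ k, W k ∈ Matrix.unitaryGroup n ℂ) :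
    ∃ U ∈ Matrix.unitaryGroup (ι × n) ℂ,
      ∀ i j, U (i₀, i) (i₀, j) = ∑ k, (p k : ℂ) * W k i j := by
  obtain ⟨V, hV, hVv⟩ := exists_mem_unitaryGroup_col_eq i₀ (fun k => ((√(p k) : ℝ) : ℂ))
    (by simpa [Real.sq_sqrt (hp _)] using hp1)
  have hK : V ⊗ₖ (1 : Matrix n n ℂ) ∈ Matrix.unitaryGroup (ι × n) ℂ :=
    Matrix.kronecker_mem_unitary hV (one_mem _)
  set D : Matrix (ι × n) (ι × n) ℂ :=
    (blockDiagonal W).submatrix (Equiv.prodComm ι n) (Equiv.prodComm ι n) with hD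
  have hDu : D ∈ Matrix.unitaryGroup (ι × n) ℂ := by
    have hW' : (fun k => W k * (W k)ᴴ) = 1 := funext fun k =>
      Matrix.mem_unitaryGroup_iff.mp (hW k)
    rw [Matrix.mem_unitaryGroup_iff, star_eq_conjTranspose, hD, conjTranspose_submatrix,
      blockDiagonal_conjTranspose, submatrix_mul_equiv,
      ← blockDiagonal_mul, hW', blockDiagonal_one]
    exact submatrix_one_equiv _
  refine ⟨star (V ⊗ₖ 1) * D * (V ⊗ₖ 1),
    mul_mem (mul_mem (Unitary.star_mem hK) hDu) hK, fun i j => ?_⟩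
  have hsq (k : ι) : ((√(p k) : ℝ) : ℂ) * ((√(p k) : ℝ) : ℂ) = p k := by
    rw [← Complex.ofReal_mul, Real.mul_self_sqrt (hp k)]
  simp only [star_eq_conjTranspose, Matrix.mul_apply, conjTranspose_apply, kroneckerMap_apply, hD,
    submatrix_apply, blockDiagonal_apply, Equiv.prodComm_apply, Prod.swap, Fintype.sum_prod_type, one_apply, hVv]
  simp [← hsq, mul_comm, mul_left_comm, apply_ite]

lemma shiftPow_mem_unitaryGroup (N : ℕ) [NeZero N] (j : ℤ) :
    shiftPow N j ∈ Matrix.unitaryGroup (ZMod N) ℂ := by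
  rw [Matrix.mem_unitaryGroup_iff']
  ext m n
  simp [shiftPow, Matrix.mul_apply, one_apply, star_eq_conjTranspose, apply_ite, eq_comm]

lemma fdCoeffPos_one_pos (a : ℕ) : 0 < fdCoeffPos a 1 := by
  unfold fdCoeffPos
  norm_num
  positivity

lemma sum_Icc_neg_eq_sum_range {M : Type*} [AddCommMonoid M] (a : ℕ) (f : ℤ → M) :
    ∑ j ∈ Finset.Icc (-(a : ℤ)) a, f j = ∑ k ∈ Finset.range (2 * a + 1), f (k - a) := by
  symm
  refine Finset.sum_bij (fun k _ => (k : ℤ) - a) ?_ ?_ ?_ (fun _ _ => rfl)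
  · intro k hk
    simp only [Finset.mem_range, Finset.mem_Icc] at *
    omega
  · intro k _ l _ h
    omega
  · intro j hj
    simp only [Finset.mem_Icc] at hj
    exact ⟨(j + a).toNat, by simp only [Finset.mem_range]; omega, by omega⟩

lemma sum_fin_ite_eq_sum_Icc {M : Type*} [AddCommMonoid M] (a Q : ℕ) (hQ : 2 * a + 1 ≤ Q)
    (f : ℤ → M) :
    ∑ k : Fin Q, (if (k : ℕ) < 2 * a + 1 then f ((k : ℕ) - a) else 0)
      = ∑ j ∈ Finset.Icc (-(a : ℤ)) a, f j := by
  rw [Fin.sum_univ_eq_sum_range (fun k : ℕ => if k < 2 * a + 1 then f (k - a) else 0),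
    sum_Icc_neg_eq_sum_range, ← Finset.sum_filter]
  congr 1
  ext k
  simp only [Finset.mem_filter, Finset.mem_range]
  omega

/-- The periodic finite-difference Laplacian `L = Σ_{j=-a}^a r_j S^j` on `N` grid points
admits a `(λ, q)` block encoding with `λ = Σ_j |r_j|` and `q = ⌈log₂(2a+1)⌉`. -/
theorem periodic_laplacian_block_encoding
    (a N : ℕ) [NeZero N] (ha : 1 ≤ a) (hN : 2 * a + 1 ≤ N)
    (lam : ℝ) (hlam : lam = ∑ j ∈ Finset.Icc (-(a : ℤ)) (a : ℤ), |fdCoeff a j|)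
    (L : Matrix (ZMod N) (ZMod N) ℂ)
    (hL : L = ∑ j ∈ Finset.Icc (-(a : ℤ)) (a : ℤ), (fdCoeff a j : ℂ) • shiftPow N j) :
    ∃ U : Matrix (Fin (2 ^ Nat.clog 2 (2 * a + 1)) × ZMod N)
            (Fin (2 ^ Nat.clog 2 (2 * a + 1)) × ZMod N) ℂ,
      U ∈ Matrix.unitaryGroup (Fin (2 ^ Nat.clog 2 (2 * a + 1)) × ZMod N) ℂ ∧
      ∀ i j : ZMod N, U (0, i) (0, j) = L i j / (lam : ℂ) := by
  have hlam0 : 0 < lam := by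
    rw [hlam]
    refine Finset.sum_pos' (fun _ _ => abs_nonneg _) ⟨1, ?_, ?_⟩
    · simp only [Finset.mem_Icc]
      omega
    · simpa [fdCoeff] using (fdCoeffPos_one_pos a).ne'
  have hQ : 2 * a + 1 ≤ 2 ^ Nat.clog 2 (2 * a + 1) := Nat.le_pow_clog (by norm_num) _
  obtain ⟨U, hU, hUL⟩ := exists_mem_unitaryGroup_block_eq_sum
    (0 : Fin (2 ^ Nat.clog 2 (2 * a + 1)))
    (fun k => if (k : ℕ) < 2 * a + 1 then |fdCoeff a ((k : ℕ) - a)| / lam else 0)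
    (fun k => by split_ifs <;> positivity)
    (by
      rw [sum_fin_ite_eq_sum_Icc a _ hQ (fun j => |fdCoeff a j| / lam), ← Finset.sum_div,
        ← hlam, div_self hlam0.ne'])
    (fun k => if fdCoeff a ((k : ℕ) - a) < 0 then -shiftPow N ((k : ℕ) - a)
      else shiftPow N ((k : ℕ) - a))
    (fun k => by
      have h := shiftPow_mem_unitaryGroup N ((k : ℕ) - a)
      split_ifs
      · rw [Matrix.mem_unitaryGroup_iff] at h ⊢
        simpa using h
      · exact h)
  refine ⟨U, hU, fun i j => ?_⟩
  rw [hUL, hL, Matrix.sum_apply, Finset.sum_div, ← sum_fin_ite_eq_sum_Icc a _ hQ]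
  refine Finset.sum_congr rfl fun k _ => ?_
  split_ifs with hk hneg
  · rw [abs_of_neg hneg]
    simp [div_mul_eq_mul_div, neg_div]
  · rw [abs_of_nonneg (not_lt.mp hneg)]
    simp [div_mul_eq_mul_div]
  all_goals simp
end

section
/- Let a ≥ 1, N ≥ 2a+1, d ≥ 1, let r_j be the (2a+1)-point central finite-difference coefficients for the second derivative, S the cyclic shift on ℂ^N, λ = Σ_{j=-a}^{a} |r_j|, and let 𝓛 = Σ_{i=0}^{d-1} I_N^{⊗i} ⊗ (Σ_{j=-a}^{a} r_j S^j) ⊗ I_N^{⊗(d-1-i)} be the d-dimensional periodic finite-difference Laplacian on (ℂ^N)^{⊗d}. Then with q = ⌈log₂ d⌉ + ⌈log₂(2a+1)⌉ there exists a unitary U on ℂ^{2^q} ⊗ (ℂ^N)^{⊗d} such that (⟨0|^{⊗q} ⊗ I) U (|0⟩^{⊗q} ⊗ I) = 𝓛/(dλ); that is, 𝓛 admits a (dλ, q) block encoding. -/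
open Matrix

/-- The Kronecker embedding `I_N^{⊗ i} ⊗ M ⊗ I_N^{⊗ (d-1-i)}` of a one-dimensional operator
`M` acting on the `i`-th of `d` registers `ℂ^N`. -/
def embedAt (N d : ℕ) (i : Fin d) (M : Matrix (ZMod N) (ZMod N) ℂ) :
    Matrix (Fin d → ZMod N) (Fin d → ZMod N) ℂ :=
  Matrix.of fun α β => if ∀ k, k ≠ i → α k = β k then M (α i) (β i) else 0

/-- A unit vector is the `i₀`-th column of some unitary matrix. -/
theorem exists_unitary_col {ι : Type*} [Fintype ι] [DecidableEq ι] (i₀ : ι) (v : ι → ℂ)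
    (hv : ‖WithLp.toLp 2 v‖ = 1) :
    ∃ V ∈ Matrix.unitaryGroup ι ℂ, ∀ i, V i i₀ = v i := by
  have ho : Orthonormal ℂ (Set.domRestrict {i₀} fun _ : ι => WithLp.toLp 2 v) :=
    ⟨fun _ => hv, fun i j hij => absurd (Subsingleton.elim i j) hij⟩
  obtain ⟨b, hb⟩ := ho.exists_orthonormalBasis_extension_of_card_eq (by simp)
  refine ⟨(EuclideanSpace.basisFun ι ℂ).toBasis.toMatrix b,
    (EuclideanSpace.basisFun ι ℂ).toMatrix_orthonormalBasis_mem_unitary b, fun i => ?_⟩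
  simp [Module.Basis.toMatrix_apply, hb i₀ rfl]

theorem blockDiagonal_mem_unitaryGroup {ι n : Type*} [Fintype ι] [DecidableEq ι] [Fintype n]
    [DecidableEq n] (W : ι → Matrix n n ℂ) (hW : ∀ k, W k ∈ Matrix.unitaryGroup n ℂ) :
    Matrix.blockDiagonal W ∈ Matrix.unitaryGroup (n × ι) ℂ := by
  rw [Matrix.mem_unitaryGroup_iff, Matrix.star_eq_conjTranspose,
    Matrix.blockDiagonal_conjTranspose, ← Matrix.blockDiagonal_mul,
    ← Matrix.blockDiagonal_one]
  congr 1
  ext1 k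
  exact Matrix.mem_unitaryGroup_iff.mp (hW k)

/-- Linear combination of unitaries with convex weights. -/
theorem exists_unitary_convex_combination {ι n : Type*} [Fintype ι] [DecidableEq ι] [Fintype n]
    [DecidableEq n] (i₀ : ι) (p : ι → ℝ) (hp : ∀ k, 0 ≤ p k) (hsum : ∑ k, p k = 1)
    (W : ι → Matrix n n ℂ) (hW : ∀ k, W k ∈ Matrix.unitaryGroup n ℂ) :
    ∃ U ∈ Matrix.unitaryGroup (ι × n) ℂ,
      ∀ α β, U (i₀, α) (i₀, β) = ∑ k, (p k : ℂ) * W k α β := by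
  obtain ⟨V, hV, hV₀⟩ := exists_unitary_col i₀ (fun k => ((√(p k) : ℝ) : ℂ)) (by
    simp [EuclideanSpace.norm_eq, Real.sq_sqrt (hp _), hsum])
  have hK : Matrix.kronecker (1 : Matrix n n ℂ) V ∈ Matrix.unitaryGroup (n × ι) ℂ :=
    Matrix.kronecker_mem_unitary (one_mem _) hV
  have hU := mul_mem (mul_mem (Unitary.star_mem hK) (blockDiagonal_mem_unitaryGroup W hW)) hK
  set U := star (Matrix.kronecker (1 : Matrix n n ℂ) V) * Matrix.blockDiagonal W *
    Matrix.kronecker (1 : Matrix n n ℂ) V with hUdef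
  refine ⟨U.submatrix (Equiv.prodComm ι n) (Equiv.prodComm ι n), ?_, fun α β => ?_⟩
  · rw [Matrix.mem_unitaryGroup_iff, Matrix.star_eq_conjTranspose] at hU ⊢
    rw [Matrix.conjTranspose_submatrix, Matrix.submatrix_mul_equiv, hU, Matrix.submatrix_one_equiv]
  · simp only [hUdef, Matrix.submatrix_apply, Equiv.prodComm_apply, Prod.swap_prod_mk,
      Matrix.mul_apply, Fintype.sum_prod_type, Matrix.star_apply, Matrix.kronecker,
      Matrix.kroneckerMap_apply, Matrix.blockDiagonal_apply, Matrix.one_apply]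
    simp only [ite_mul, one_mul, zero_mul, mul_ite, mul_zero, apply_ite star, star_zero,
      Finset.sum_ite_eq', Finset.mem_univ, if_true, Finset.sum_ite_irrel,
      Finset.sum_const_zero, hV₀]
    refine Finset.sum_congr rfl fun k _ => ?_
    have h : (p k : ℂ) = ((√(p k) : ℝ) : ℂ) * ((√(p k) : ℝ) : ℂ) := by
      rw [← Complex.ofReal_mul, Real.mul_self_sqrt (hp k)]
    rw [h]
    simp
    ring

/-- Linear combination of unitaries with real coefficients, indexed by a type that embeds into
the ancilla register. -/
theorem exists_unitary_linear_combination {κ ι n : Type*} [Fintype κ] [Fintype ι] [DecidableEq ι]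
    [Fintype n] [DecidableEq n] (hcard : Fintype.card κ ≤ Fintype.card ι) (i₀ : ι)
    (c : κ → ℝ) (hc : 0 < ∑ k, |c k|)
    (W : κ → Matrix n n ℂ) (hW : ∀ k, W k ∈ Matrix.unitaryGroup n ℂ) :
    ∃ U ∈ Matrix.unitaryGroup (ι × n) ℂ,
      ∀ α β, U (i₀, α) (i₀, β) = (∑ k, (c k : ℂ) * W k α β) / ((∑ k, |c k| : ℝ) : ℂ) := by
  obtain ⟨e⟩ := Function.Embedding.nonempty_of_card_le hcard
  set s := ∑ k, |c k|
  set p : ι → ℝ := Function.extend e (fun k => |c k| / s) 0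
  set W' : ι → Matrix n n ℂ :=
    Function.extend e (fun k => if 0 ≤ c k then W k else -W k) 1 with hW'
  have hpe (k : κ) : p (e k) = |c k| / s := e.injective.extend_apply _ _ _
  have hWe (k : κ) : W' (e k) = if 0 ≤ c k then W k else -W k := e.injective.extend_apply _ _ _
  have hp0 (i : ι) (hi : i ∉ Set.range e) : p i = 0 := Function.extend_apply' _ _ _ hi
  obtain ⟨U, hU, hU₀⟩ := exists_unitary_convex_combination i₀ p (fun i => by
      by_cases hi : i ∈ Set.range e
      · obtain ⟨k, rfl⟩ := hi
        rw [hpe]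
        positivity
      · exact (hp0 i hi).ge)
    (by
      rw [← Fintype.sum_of_injective e e.injective (fun k => |c k| / s) p hp0 fun k => (hpe k).symm,
        ← Finset.sum_div, div_self hc.ne'])
    W' (fun i => by
      by_cases hi : i ∈ Set.range e
      · obtain ⟨k, rfl⟩ := hi
        rw [hWe]
        split_ifs
        · exact hW k
        · simpa [Matrix.mem_unitaryGroup_iff] using hW k
      · rw [hW', Function.extend_apply' _ _ _ hi]
        exact one_mem _)
  refine ⟨U, hU, fun α β => ?_⟩
  rw [hU₀, Finset.sum_div]
  refine (Fintype.sum_of_injective e e.injective _ _ (fun i hi => by simp [hp0 i hi])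
    fun k => ?_).symm
  rw [hpe, hWe]
  split_ifs with h
  · rw [abs_of_nonneg h]
    push_cast
    ring
  · rw [abs_of_neg (not_le.mp h)]
    push_cast
    rw [Matrix.neg_apply]
    ring

theorem translation_mem_unitaryGroup {G : Type*} [AddCommGroup G] [Fintype G] [DecidableEq G]
    (g : G) :
    (Matrix.of fun m n : G => if m = n + g then (1 : ℂ) else 0) ∈ Matrix.unitaryGroup G ℂ := by
  rw [Matrix.mem_unitaryGroup_iff]
  ext m n
  have h (x y : G) : x = y + g ↔ x - g = y := sub_eq_iff_eq_add.symm
  simp [Matrix.mul_apply, Matrix.one_apply, h, apply_ite star, eq_comm]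

theorem embedAt_shiftPow_mem_unitaryGroup (N d : ℕ) [NeZero N] (i : Fin d) (j : ℤ) :
    embedAt N d i (shiftPow N j) ∈ Matrix.unitaryGroup (Fin d → ZMod N) ℂ := by
  convert translation_mem_unitaryGroup (Pi.single i (j : ZMod N) : Fin d → ZMod N) using 1
  ext α β
  simp only [embedAt, shiftPow, Matrix.of_apply, ← ite_and]
  refine if_congr ⟨fun ⟨h₁, h₂⟩ => ?_, ?_⟩ rfl rfl
  · ext k
    by_cases hk : k = i
    · subst hk
      simpa using h₂
    · simpa [hk] using h₁ k hk
  · rintro rfl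
    exact ⟨fun k hk => by simp [hk], by simp⟩

theorem sum_abs_fdCoeff_pos (a : ℕ) (ha : 1 ≤ a) :
    0 < ∑ j ∈ Finset.Icc (-(a : ℤ)) (a : ℤ), |fdCoeff a j| := by
  refine Finset.sum_pos' (fun _ _ => abs_nonneg _) ⟨1, ?_, abs_pos.mpr ?_⟩
  · rw [Finset.mem_Icc]
    omega
  · simp [fdCoeff, fdCoeffPos, Nat.factorial_ne_zero]

/-- The `d`-dimensional periodic finite-difference Laplacian
`𝓛 = Σ_i I^{⊗i} ⊗ (Σ_j r_j S^j) ⊗ I^{⊗(d-1-i)}` admits a `(dλ, q)` block encoding with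
`λ = Σ_j |r_j|` and `q = ⌈log₂ d⌉ + ⌈log₂(2a+1)⌉`. -/
theorem d_dim_periodic_laplacian_block_encoding
    (a N d : ℕ) [NeZero N] (ha : 1 ≤ a) (hN : 2 * a + 1 ≤ N) (hd : 1 ≤ d)
    (lam : ℝ) (hlam : lam = ∑ j ∈ Finset.Icc (-(a : ℤ)) (a : ℤ), |fdCoeff a j|)
    (𝓛 : Matrix (Fin d → ZMod N) (Fin d → ZMod N) ℂ)
    (h𝓛 : 𝓛 = ∑ i : Fin d, embedAt N d i
        (∑ j ∈ Finset.Icc (-(a : ℤ)) (a : ℤ), (fdCoeff a j : ℂ) • shiftPow N j)) :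
    ∃ U : Matrix (Fin (2 ^ (Nat.clog 2 d + Nat.clog 2 (2 * a + 1))) × (Fin d → ZMod N))
            (Fin (2 ^ (Nat.clog 2 d + Nat.clog 2 (2 * a + 1))) × (Fin d → ZMod N)) ℂ,
      U ∈ Matrix.unitaryGroup (Fin (2 ^ (Nat.clog 2 d + Nat.clog 2 (2 * a + 1))) × (Fin d → ZMod N)) ℂ ∧
      ∀ α β : Fin d → ZMod N, U (0, α) (0, β) = 𝓛 α β / ((d : ℂ) * (lam : ℂ)) := by
  subst hlam h𝓛
  have hcard : Fintype.card (Fin d × Finset.Icc (-(a : ℤ)) (a : ℤ)) ≤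
      Fintype.card (Fin (2 ^ (Nat.clog 2 d + Nat.clog 2 (2 * a + 1)))) := by
    have h : ((a : ℤ) + 1 - -(a : ℤ)).toNat = 2 * a + 1 := by omega
    rw [Fintype.card_prod, Fintype.card_fin, Fintype.card_fin, Fintype.card_coe, Int.card_Icc, h,
      pow_add]
    exact Nat.mul_le_mul (Nat.le_pow_clog one_lt_two _) (Nat.le_pow_clog one_lt_two _)
  have hs : ∑ k : Fin d × Finset.Icc (-(a : ℤ)) (a : ℤ), |fdCoeff a k.2| =
      d * ∑ j ∈ Finset.Icc (-(a : ℤ)) (a : ℤ), |fdCoeff a j| := by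
    rw [Fintype.sum_prod_type, ← Finset.sum_coe_sort (Finset.Icc (-(a : ℤ)) (a : ℤ))]
    simp
  obtain ⟨U, hU, hU₀⟩ := exists_unitary_linear_combination hcard 0 (fun k => fdCoeff a k.2)
    (by
      rw [hs]
      exact mul_pos (by exact_mod_cast hd) (sum_abs_fdCoeff_pos a ha))
    (fun k => embedAt N d k.1 (shiftPow N k.2))
    (fun k => embedAt_shiftPow_mem_unitaryGroup N d k.1 k.2)
  refine ⟨U, hU, fun α β => ?_⟩
  rw [hU₀, hs, Complex.ofReal_mul, Complex.ofReal_natCast, Fintype.sum_prod_type,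
    Matrix.sum_apply]
  congr 1
  refine Finset.sum_congr rfl fun i _ => ?_
  rw [Finset.sum_coe_sort (Finset.Icc (-(a : ℤ)) (a : ℤ))
    fun j => (fdCoeff a j : ℂ) * embedAt N d i (shiftPow N j) α β]
  simp only [embedAt, Matrix.of_apply]
  split_ifs
  · simp [Matrix.sum_apply]
  · simp
end

section
/- Linear combination of unitaries (LCU): let m ≥ 1, k ≥ 1, q = ⌈log₂ k⌉, let U_0, …, U_{2^q - 1} be unitary m×m matrices, and let β_0, …, β_{2^q - 1} be nonnegative reals with Σ_l β_l = 1 and β_l = 0 for l ≥ k. Let P be any unitary on ℂ^{2^q} whose 0-th column is Σ_l √(β_l) e_l, and let SEL = Σ_{l=0}^{2^q - 1} |l⟩⟨l| ⊗ U_l on ℂ^{2^q} ⊗ ℂ^m. Then the unitary W = (P† ⊗ I_m) · SEL · (P ⊗ I_m) satisfies (⟨0| ⊗ I_m) W (|0⟩ ⊗ I_m) = Σ_{l} β_l U_l. -/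
open Matrix
open scoped Kronecker

/-- Linear combination of unitaries (LCU): with `q = ⌈log₂ k⌉`, unitaries `U_l` on `ℂ^m`,
nonnegative coefficients `β_l` summing to `1` and vanishing for `l ≥ k`, a unitary `P`
whose 0-th column is `Σ_l √β_l e_l`, and `SEL = Σ_l |l⟩⟨l| ⊗ U_l`, the unitary
`W = (P† ⊗ I) · SEL · (P ⊗ I)` compresses on the ancilla state `e_0` to `Σ_l β_l U_l`. -/
theorem lcu_block_encoding (m k : ℕ) (hm : 1 ≤ m) (hk : 1 ≤ k)
    (U : Fin (2 ^ Nat.clog 2 k) → Matrix (Fin m) (Fin m) ℂ)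
    (hU : ∀ l, U l ∈ Matrix.unitaryGroup (Fin m) ℂ)
    (β : Fin (2 ^ Nat.clog 2 k) → ℝ)
    (hβ0 : ∀ l, 0 ≤ β l) (hβ1 : ∑ l, β l = 1)
    (hβk : ∀ l : Fin (2 ^ Nat.clog 2 k), k ≤ (l : ℕ) → β l = 0)
    (P : Matrix (Fin (2 ^ Nat.clog 2 k)) (Fin (2 ^ Nat.clog 2 k)) ℂ)
    (hP : P ∈ Matrix.unitaryGroup (Fin (2 ^ Nat.clog 2 k)) ℂ)
    (hPcol : ∀ l, P l 0 = (Real.sqrt (β l) : ℂ))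
    (SEL : Matrix (Fin (2 ^ Nat.clog 2 k) × Fin m) (Fin (2 ^ Nat.clog 2 k) × Fin m) ℂ)
    (hSEL : ∀ l i l' i', SEL (l, i) (l', i') = if l = l' then U l i i' else 0)
    (W : Matrix (Fin (2 ^ Nat.clog 2 k) × Fin m) (Fin (2 ^ Nat.clog 2 k) × Fin m) ℂ)
    (hW : W = (Pᴴ ⊗ₖ (1 : Matrix (Fin m) (Fin m) ℂ)) * SEL *
        (P ⊗ₖ (1 : Matrix (Fin m) (Fin m) ℂ))) :
    ∀ i j : Fin m, W (0, i) (0, j) = (∑ l, (β l : ℂ) • U l) i j := by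
  intro i j
  subst hW
  simp only [Matrix.mul_apply, Fintype.sum_prod_type, Matrix.kroneckerMap_apply, hSEL,
    Matrix.conjTranspose_apply, Matrix.one_apply, Matrix.sum_apply, Matrix.smul_apply, hPcol,
    mul_ite, ite_mul, mul_one, mul_zero, zero_mul, Finset.sum_ite_eq, Finset.sum_ite_eq',
    Finset.sum_ite_irrel, Finset.sum_const_zero, Finset.mem_univ, if_true]
  refine Finset.sum_congr rfl fun l _ => ?_
  have hsq : (Real.sqrt (β l) : ℂ) * Real.sqrt (β l) = β l := by
    exact_mod_cast Real.mul_self_sqrt (hβ0 l)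
  rw [Complex.star_def, Complex.conj_ofReal, mul_right_comm, hsq, smul_eq_mul]
end

section
/- Let a ≥ 1 and let r_j be the (2a+1)-point central finite-difference coefficients for the second derivative. If ψ : ℝ → ℝ is (2a+1)-times continuously differentiable and M = sup_{x ∈ ℝ} |ψ^{(2a+1)}(x)| is finite, then for every x ∈ ℝ and every h > 0, |h^{-2} Σ_{j=-a}^{a} r_j ψ(x + j h) − ψ''(x)| ≤ (π^{3/2}/9) · e^{2a(1 − ln 2)} · h^{2a−1} · M. -/
open Finset

theorem sum_Icc_neg_eq_add_sum_Icc_one {β : Type*} [AddCommMonoid β] (f : ℤ → β) (n : ℕ) :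
    ∑ j ∈ Icc (-(n : ℤ)) n, f j = f 0 + ∑ k ∈ Icc 1 n, (f k + f (-k)) := by
  induction n with
  | zero => simp
  | succ n ih =>
    have hIcc : Icc (-((n + 1 : ℕ) : ℤ)) ((n + 1 : ℕ) : ℤ) =
        insert (((n + 1 : ℕ) : ℤ)) (insert (-((n + 1 : ℕ) : ℤ)) (Icc (-(n : ℤ)) n)) := by
      ext j
      simp only [mem_Icc, mem_insert]
      omega
    rw [hIcc, sum_insert (by simp; omega), sum_insert (by simp), ih,
      sum_Icc_succ_top (by omega)]
    abel

theorem sum_range_two_mul_add_one_eq_sum_Icc {β : Type*} [AddCommMonoid β] (f : ℤ → β) (n : ℕ) :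
    ∑ i ∈ range (2 * n + 1), f ((i : ℤ) - n) = ∑ j ∈ Icc (-(n : ℤ)) n, f j := by
  refine sum_nbij' (fun i => (i : ℤ) - n) (fun j => (j + n).toNat) ?_ ?_ ?_ ?_ ?_
  · intro i hi
    simp only [mem_range, mem_Icc] at *
    omega
  · intro j hj
    simp only [mem_range, mem_Icc] at *
    omega
  · intro i _
    simp
  · intro j hj
    simp only [mem_Icc] at hj
    omega
  · intro i _
    rfl

/-- The central difference of order `2n` annihilates even powers below `2n`, in folded form. -/
theorem sum_alternating_central_pow_eq_zero {n p : ℕ} (hp : Even p) (hpn : p < 2 * n) :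
    ((n.factorial : ℝ) ^ 2)⁻¹ * 0 ^ p +
      2 * ∑ k ∈ Icc 1 n, (-1 : ℝ) ^ k * (k : ℝ) ^ p /
        (((n - k).factorial : ℝ) * ((n + k).factorial : ℝ)) = 0 := by
  set g : ℤ → ℝ := fun j => (-1 : ℝ) ^ j.natAbs * (j : ℝ) ^ p /
    (((n - j).toNat.factorial : ℝ) * ((n + j).toNat.factorial : ℝ)) with hg
  have hzero : ∑ j ∈ Icc (-(n : ℤ)) n, g j = 0 := by
    rw [← sum_range_two_mul_add_one_eq_sum_Icc]
    have h := congrFun (fwdDiff_iter_pow_eq_zero_of_lt (R := ℝ) hpn) (-(n : ℝ))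
    rw [fwdDiff_iter_eq_sum_shift] at h
    have hscale : ∑ i ∈ range (2 * n + 1), g ((i : ℤ) - n) =
        (-1) ^ n * ((2 * n).factorial : ℝ)⁻¹ * ∑ i ∈ range (2 * n + 1),
          ((-1 : ℤ) ^ (2 * n - i) * ((2 * n).choose i : ℤ)) • (-(n : ℝ) + i • (1 : ℝ)) ^ p := by
      rw [mul_sum]
      refine sum_congr rfl fun i hi => ?_
      have hi' : i ≤ 2 * n := by simp at hi; omega
      have h1 : ((n : ℤ) - ((i : ℤ) - n)).toNat = 2 * n - i := by omega
      have h2 : ((n : ℤ) + ((i : ℤ) - n)).toNat = i := by omega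
      have hs : (-1 : ℝ) ^ ((i : ℤ) - n).natAbs = (-1) ^ n * (-1) ^ (2 * n - i) := by
        rw [← pow_add]
        refine neg_one_pow_congr ?_
        simp only [Nat.even_iff]
        omega
      simp only [hg, h1, h2, hs, zsmul_eq_mul, nsmul_eq_mul]
      push_cast
      rw [Nat.cast_choose ℝ hi']
      have := Nat.factorial_ne_zero (2 * n)
      field_simp
      ring
    rw [hscale, h]
    simp
  rw [sum_Icc_neg_eq_add_sum_Icc_one] at hzero
  refine Eq.trans ?_ hzero
  rw [mul_sum]
  congr 1
  · simp [hg, sq]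
    ring
  · refine sum_congr rfl fun k hk => ?_
    have hk' := mem_Icc.mp hk
    have h1 : ((n : ℤ) - k).toNat = n - k := by omega
    have h2 : ((n : ℤ) + k).toNat = n + k := by omega
    have h3 : ((n : ℤ) - -k).toNat = n + k := by omega
    have h4 : ((n : ℤ) + -k).toNat = n - k := by omega
    simp only [hg, h1, h2, h3, h4, Int.natAbs_neg, Int.natAbs_natCast, Int.cast_neg,
      Int.cast_natCast, hp.neg_pow]
    ring

theorem fdCoeff_natCast {a k : ℕ} (hk : 1 ≤ k) : fdCoeff a k = fdCoeffPos a k := by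
  simp [fdCoeff, Nat.one_le_iff_ne_zero.mp hk]

theorem fdCoeff_neg_natCast {a k : ℕ} (hk : 1 ≤ k) : fdCoeff a (-k) = fdCoeffPos a k := by
  simp [fdCoeff, Nat.one_le_iff_ne_zero.mp hk]

theorem sum_fdCoeff_mul (a : ℕ) (f : ℤ → ℝ) :
    ∑ j ∈ Icc (-(a : ℤ)) a, fdCoeff a j * f j =
      ∑ k ∈ Icc 1 a, fdCoeffPos a k * (f k + f (-k) - 2 * f 0) := by
  rw [sum_Icc_neg_eq_add_sum_Icc_one, fdCoeff, if_pos rfl, mul_assoc, sum_mul, mul_sum,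
    ← sum_add_distrib]
  refine sum_congr rfl fun k hk => ?_
  rw [fdCoeff_natCast (mem_Icc.mp hk).1, fdCoeff_neg_natCast (mem_Icc.mp hk).1]
  ring

/-- The stencil differentiates monomials of degree at most `2a` exactly at the origin. -/
theorem sum_fdCoeff_mul_pow {a m : ℕ} (hm : m ≤ 2 * a) :
    ∑ j ∈ Icc (-(a : ℤ)) a, fdCoeff a j * (j : ℝ) ^ m = if m = 2 then 2 else 0 := by
  rw [sum_fdCoeff_mul a (fun j => (j : ℝ) ^ m)]
  rcases Nat.even_or_odd m with he | ho
  · rcases Nat.eq_zero_or_pos m with rfl | hpos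
    · refine (sum_eq_zero fun k _ => ?_).trans (by simp)
      norm_num
    · obtain ⟨p, rfl⟩ : ∃ p, m = p + 2 := ⟨m - 2, by obtain ⟨c, rfl⟩ := he; omega⟩
      have hp : Even p := by simpa [Nat.even_add] using he
      have h := sum_alternating_central_pow_eq_zero hp (show p < 2 * a by omega)
      have hsum : ∑ k ∈ Icc 1 a, fdCoeffPos a k *
          ((((k : ℕ) : ℤ) : ℝ) ^ (p + 2) + ((-(k : ℤ) : ℤ) : ℝ) ^ (p + 2) -
            2 * ((0 : ℤ) : ℝ) ^ (p + 2)) =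
          -2 * (a.factorial : ℝ) ^ 2 * (2 * ∑ k ∈ Icc 1 a, (-1 : ℝ) ^ k * (k : ℝ) ^ p /
            (((a - k).factorial : ℝ) * ((a + k).factorial : ℝ))) := by
        rw [mul_sum, mul_sum]
        refine sum_congr rfl fun k hk => ?_
        have hk0 : (k : ℝ) ≠ 0 := by
          have := (mem_Icc.mp hk).1
          positivity
        simp only [fdCoeffPos, Int.cast_neg, Int.cast_natCast, he.neg_pow, Int.cast_zero]
        field_simp
        simp
        ring
      rw [hsum, eq_neg_of_add_eq_zero_right h]
      have ha := Nat.factorial_ne_zero a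
      rcases Nat.eq_zero_or_pos p with rfl | hp0
      · field_simp
        simp
      · simp [hp0.ne']
  · rw [if_neg (by rintro rfl; exact absurd ho (by decide))]
    refine sum_eq_zero fun k _ => ?_
    have : m ≠ 0 := by rintro rfl; exact absurd ho (by decide)
    simp [ho.neg_pow, this]

theorem abs_sub_taylor_le {f : ℝ → ℝ} {n : ℕ} (hf : ContDiff ℝ (n + 1 : ℕ) f) {M : ℝ}
    (hM : ∀ x, |iteratedDeriv (n + 1) f x| ≤ M) (x y : ℝ) :
    |f (x + y) - ∑ k ∈ range (n + 1), iteratedDeriv k f x / k.factorial * y ^ k| ≤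
      M * |y| ^ (n + 1) / (n + 1).factorial := by
  rcases eq_or_ne y 0 with rfl | hy
  · simp [sum_range_succ']
  have hne : x ≠ x + y := by simpa using hy
  obtain ⟨z, -, hz⟩ := taylor_mean_remainder_lagrange_iteratedDeriv (n := n) hne
    (by exact_mod_cast hf.contDiffOn)
  have hT : taylorWithinEval f n (Set.uIcc x (x + y)) x (x + y) =
      ∑ k ∈ range (n + 1), iteratedDeriv k f x / k.factorial * y ^ k := by
    rw [taylor_within_apply]
    refine sum_congr rfl fun k hk => ?_
    rw [iteratedDerivWithin_eq_iteratedDeriv (uniqueDiffOn_uIcc hne)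
      ((hf.of_le (by exact_mod_cast (mem_range.mp hk).le)).contDiffAt) Set.left_mem_uIcc,
      smul_eq_mul, add_sub_cancel_left]
    ring
  rw [← hT, hz, add_sub_cancel_left, abs_div, abs_mul, abs_pow, Nat.abs_cast]
  gcongr
  exact hM z

theorem factorial_sq_mul_le {a k : ℕ} (hk : 1 ≤ k) (hka : k ≤ a) :
    (a + 1) * a.factorial ^ 2 ≤ a * ((a - k).factorial * (a + k).factorial) := by
  induction k, hk using Nat.le_induction with
  | base =>
    obtain ⟨b, rfl⟩ := Nat.exists_eq_add_of_le' hka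
    simp only [Nat.add_sub_cancel, Nat.factorial_succ]
    exact le_of_eq (by ring)
  | succ k hk ih =>
    refine (ih (by omega)).trans (Nat.mul_le_mul_left _ ?_)
    obtain ⟨b, rfl⟩ := Nat.exists_eq_add_of_le' hka
    rw [show b + (k + 1) - k = b + 1 by omega, show b + (k + 1) - (k + 1) = b by omega,
      show b + (k + 1) + (k + 1) = b + (k + 1) + k + 1 by omega, Nat.factorial_succ,
      Nat.factorial_succ (b + (k + 1) + k)]
    calc (b + 1) * b.factorial * (b + (k + 1) + k).factorial
        ≤ (b + (k + 1) + k + 1) * b.factorial * (b + (k + 1) + k).factorial := by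
          gcongr; omega
      _ = _ := by ring

theorem abs_fdCoeffPos_mul_pow_le {a k : ℕ} (hk : 1 ≤ k) (hka : k ≤ a) :
    |fdCoeffPos a k| * (k : ℝ) ^ (2 * a + 1) ≤ 2 * (a : ℝ) ^ (2 * a) / (a + 1) := by
  obtain ⟨m, hm⟩ : ∃ m, 2 * a = m + 1 := ⟨2 * a - 1, by omega⟩
  have hk0 : (0 : ℝ) < k := by exact_mod_cast hk
  have ha0 : (0 : ℝ) < a := by exact_mod_cast hk.trans hka
  have hfac : ((a : ℝ) + 1) * (a.factorial : ℝ) ^ 2 ≤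
      a * (((a - k).factorial : ℝ) * ((a + k).factorial : ℝ)) := by
    exact_mod_cast factorial_sq_mul_le hk hka
  have hpow : (k : ℝ) ^ m ≤ (a : ℝ) ^ m := by gcongr
  have habs : |fdCoeffPos a k| * (k : ℝ) ^ (2 * a + 1) =
      2 * (a.factorial : ℝ) ^ 2 / (((a - k).factorial : ℝ) * ((a + k).factorial : ℝ)) *
        (k : ℝ) ^ m := by
    rw [fdCoeffPos, abs_div, abs_mul, abs_mul, abs_pow, hm]
    simp only [abs_neg, abs_one, one_pow, abs_mul, abs_pow, Nat.abs_cast, abs_two]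
    field_simp
    ring
  have hratio : 2 * (a.factorial : ℝ) ^ 2 / (((a - k).factorial : ℝ) * ((a + k).factorial : ℝ)) ≤
      2 * a / (a + 1) := by
    rw [div_le_div_iff₀ (by positivity) (by positivity)]
    nlinarith
  calc _ = _ := habs
    _ ≤ 2 * a / (a + 1) * (a : ℝ) ^ m := by gcongr
    _ = _ := by rw [hm]; ring

theorem two_mul_pow_self_div_factorial_le_exp {n : ℕ} (hn : 1 ≤ n) :
    2 * ((n : ℝ) ^ n / n.factorial) ≤ Real.exp n := by
  obtain ⟨m, rfl⟩ := Nat.exists_eq_add_of_le' hn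
  refine le_trans ?_ (Real.sum_le_exp_of_nonneg (Nat.cast_nonneg _) (m + 1 + 1))
  rw [sum_range_succ, sum_range_succ]
  have hterm : ((m + 1 : ℕ) : ℝ) ^ m / m.factorial =
      ((m + 1 : ℕ) : ℝ) ^ (m + 1) / (m + 1).factorial := by
    rw [Nat.factorial_succ, pow_succ]
    push_cast
    field_simp
  have hrest : 0 ≤ ∑ i ∈ range m, ((m + 1 : ℕ) : ℝ) ^ i / i.factorial := by positivity
  rw [hterm]
  linarith

theorem fd_error_constant_le {a : ℕ} (ha : 1 ≤ a) :
    4 * a * (a : ℝ) ^ (2 * a) / ((a + 1) * (2 * a + 1).factorial) ≤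
      Real.pi ^ ((3 : ℝ) / 2) / 9 * Real.exp (2 * a * (1 - Real.log 2)) := by
  have ha' : (1 : ℝ) ≤ a := by exact_mod_cast ha
  have hpi : (1 : ℝ) / 3 ≤ Real.pi ^ ((3 : ℝ) / 2) / 9 := by
    have : Real.pi ^ (1 : ℝ) ≤ Real.pi ^ ((3 : ℝ) / 2) :=
      Real.rpow_le_rpow_of_exponent_le (by linarith [Real.pi_gt_three]) (by norm_num)
    rw [Real.rpow_one] at this
    linarith [Real.pi_gt_three]
  have hexp : Real.exp (2 * a * (1 - Real.log 2)) = Real.exp (2 * a) / 2 ^ (2 * a) := by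
    rw [mul_sub, mul_one, Real.exp_sub, show 2 * (a : ℝ) * Real.log 2 =
      ((2 * a : ℕ) : ℝ) * Real.log 2 by push_cast; ring, Real.exp_nat_mul,
      Real.exp_log two_pos]
  have hfac := two_mul_pow_self_div_factorial_le_exp (n := 2 * a) (by omega)
  push_cast [mul_pow] at hfac
  have hpow : (a : ℝ) ^ (2 * a) / (2 * a).factorial ≤
      Real.exp (2 * a * (1 - Real.log 2)) / 2 := by
    rw [hexp, div_div, le_div_iff₀ (by positivity)]
    refine le_trans (le_of_eq ?_) hfac
    ring
  have hcoef : 4 * (a : ℝ) / ((a + 1) * (2 * a + 1)) ≤ 2 / 3 := by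
    rw [div_le_div_iff₀ (by positivity) (by norm_num)]
    nlinarith
  calc 4 * a * (a : ℝ) ^ (2 * a) / ((a + 1) * (2 * a + 1).factorial)
      = 4 * (a : ℝ) / ((a + 1) * (2 * a + 1)) * ((a : ℝ) ^ (2 * a) / (2 * a).factorial) := by
        rw [Nat.factorial_succ]
        push_cast
        field_simp
    _ ≤ 2 / 3 * (Real.exp (2 * a * (1 - Real.log 2)) / 2) := by gcongr
    _ = 1 / 3 * Real.exp (2 * a * (1 - Real.log 2)) := by ring
    _ ≤ _ := by gcongr

theorem sum_abs_fdCoeff_mul_pow_le (a : ℕ) :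
    ∑ j ∈ Icc (-(a : ℤ)) a, |fdCoeff a j| * |(j : ℝ)| ^ (2 * a + 1) ≤
      4 * a * (a : ℝ) ^ (2 * a) / (a + 1) := by
  rw [sum_Icc_neg_eq_add_sum_Icc_one]
  have hk : ∀ k ∈ Icc 1 a, |fdCoeff a k| * |((k : ℤ) : ℝ)| ^ (2 * a + 1) +
      |fdCoeff a (-k)| * |((-(k : ℤ) : ℤ) : ℝ)| ^ (2 * a + 1) ≤
      4 * (a : ℝ) ^ (2 * a) / (a + 1) := by
    intro k hk
    obtain ⟨h1, h2⟩ := mem_Icc.mp hk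
    rw [fdCoeff_natCast h1, fdCoeff_neg_natCast h1]
    have h := abs_fdCoeffPos_mul_pow_le h1 h2
    simp only [Int.cast_neg, Int.cast_natCast, abs_neg, Nat.abs_cast]
    calc _ ≤ 2 * (2 * (a : ℝ) ^ (2 * a) / (a + 1)) := by linarith
      _ = _ := by ring
  have h := sum_le_card_nsmul _ _ _ hk
  rw [Nat.card_Icc, Nat.add_sub_cancel, nsmul_eq_mul] at h
  simp only [Int.cast_zero, abs_zero, ne_eq, Nat.succ_ne_zero, not_false_eq_true, zero_pow,
    mul_zero, zero_add]
  exact h.trans (le_of_eq (by ring))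

/-- Error bound for the `(2a+1)`-point central finite-difference approximation of the second
derivative: if `ψ` is `C^{2a+1}` with `|ψ^{(2a+1)}| ≤ M` everywhere, then for every `x` and
every `h > 0`,
`|h⁻² Σ_{j=-a}^a r_j ψ(x + jh) − ψ''(x)| ≤ (π^{3/2}/9) e^{2a(1−ln 2)} h^{2a−1} M`. -/
theorem fd_stencil_error (a : ℕ) (ha : 1 ≤ a) (ψ : ℝ → ℝ)
    (hψ : ContDiff ℝ (2 * a + 1 : ℕ) ψ)
    (M : ℝ) (hM : ∀ x : ℝ, |iteratedDeriv (2 * a + 1) ψ x| ≤ M) :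
    ∀ x : ℝ, ∀ h : ℝ, 0 < h →
      |(∑ j ∈ Finset.Icc (-(a : ℤ)) (a : ℤ), fdCoeff a j * ψ (x + j * h)) / h ^ 2
          - iteratedDeriv 2 ψ x|
        ≤ Real.pi ^ ((3 : ℝ) / 2) / 9 * Real.exp (2 * a * (1 - Real.log 2))
            * h ^ (2 * a - 1) * M := by
  intro x h hh
  have hM0 : 0 ≤ M := (abs_nonneg _).trans (hM 0)
  set T : ℝ → ℝ := fun y => ∑ k ∈ range (2 * a + 1), iteratedDeriv k ψ x / k.factorial * y ^ k
    with hT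
  have hexact : ∑ j ∈ Icc (-(a : ℤ)) (a : ℤ), fdCoeff a j * T (j * h) =
      h ^ 2 * iteratedDeriv 2 ψ x := by
    calc ∑ j ∈ Icc (-(a : ℤ)) (a : ℤ), fdCoeff a j * T (j * h)
        = ∑ k ∈ range (2 * a + 1), iteratedDeriv k ψ x / k.factorial * h ^ k *
            ∑ j ∈ Icc (-(a : ℤ)) (a : ℤ), fdCoeff a j * (j : ℝ) ^ k := by
          simp only [hT, mul_sum]
          rw [sum_comm]
          refine sum_congr rfl fun k _ => sum_congr rfl fun j _ => ?_
          ring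
      _ = ∑ k ∈ range (2 * a + 1), iteratedDeriv k ψ x / k.factorial * h ^ k *
            if k = 2 then 2 else 0 := by
          refine sum_congr rfl fun k hk => ?_
          rw [sum_fdCoeff_mul_pow (by simp at hk; omega)]
      _ = h ^ 2 * iteratedDeriv 2 ψ x := by
          simp only [mul_ite, mul_zero]
          rw [sum_ite_eq', if_pos (by simp; omega), Nat.factorial_two]
          push_cast
          ring
  have herr : (∑ j ∈ Icc (-(a : ℤ)) (a : ℤ), fdCoeff a j * ψ (x + j * h)) / h ^ 2 -
      iteratedDeriv 2 ψ x =
      (∑ j ∈ Icc (-(a : ℤ)) (a : ℤ), fdCoeff a j * (ψ (x + j * h) - T (j * h))) / h ^ 2 := by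
    simp only [mul_sub, sum_sub_distrib, hexact]
    rw [sub_div, mul_div_cancel_left₀ _ (pow_ne_zero 2 hh.ne')]
  have hbound : |∑ j ∈ Icc (-(a : ℤ)) (a : ℤ), fdCoeff a j * (ψ (x + j * h) - T (j * h))| ≤
      4 * a * (a : ℝ) ^ (2 * a) / (a + 1) * (M * h ^ (2 * a + 1) / (2 * a + 1).factorial) := by
    calc _ ≤ ∑ j ∈ Icc (-(a : ℤ)) (a : ℤ), |fdCoeff a j * (ψ (x + j * h) - T (j * h))| :=
          abs_sum_le_sum_abs _ _
      _ ≤ ∑ j ∈ Icc (-(a : ℤ)) (a : ℤ), |fdCoeff a j| * |(j : ℝ)| ^ (2 * a + 1) *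
            (M * h ^ (2 * a + 1) / (2 * a + 1).factorial) := by
          refine sum_le_sum fun j _ => ?_
          rw [abs_mul, mul_assoc]
          refine mul_le_mul_of_nonneg_left ?_ (abs_nonneg _)
          refine (abs_sub_taylor_le hψ hM x (j * h)).trans (le_of_eq ?_)
          rw [abs_mul, abs_of_pos hh, mul_pow]
          ring
      _ ≤ _ := by
          rw [← sum_mul]
          gcongr
          exact sum_abs_fdCoeff_mul_pow_le a
  rw [herr, abs_div, abs_of_pos (pow_pos hh 2), div_le_iff₀ (pow_pos hh 2)]
  have hpow : h ^ (2 * a + 1) = h ^ (2 * a - 1) * h ^ 2 := by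
    rw [← pow_add]
    congr 1
    omega
  calc _ ≤ _ := hbound
    _ = 4 * a * (a : ℝ) ^ (2 * a) / ((a + 1) * (2 * a + 1).factorial) *
          (h ^ (2 * a - 1) * M * h ^ 2) := by
        rw [hpow]
        field_simp
    _ ≤ Real.pi ^ ((3 : ℝ) / 2) / 9 * Real.exp (2 * a * (1 - Real.log 2)) *
          (h ^ (2 * a - 1) * M * h ^ 2) := by
        gcongr
        exact fd_error_constant_le ha
    _ = _ := by ring
end

section
/- Let a ≥ 1 and let r_j be the (2a+1)-point central finite-difference coefficients for the second derivative. Then the sum of the absolute values of the off-center coefficients is uniformly bounded: Σ_{1 ≤ |j| ≤ a} |r_j| = 2 Σ_{j=1}^{a} |r_j| ≤ 2π²/3. -/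
theorem factorial_sq_le_factorial_sub_mul_factorial_add {a k : ℕ} (hk : k ≤ a) :
    (Nat.factorial a) ^ 2 ≤ Nat.factorial (a - k) * Nat.factorial (a + k) := by
  have hc := Nat.choose_le_centralBinom (a - k) a
  have hmid := Nat.choose_mul_factorial_mul_factorial (show a ≤ 2 * a by lia)
  have hoff := Nat.choose_mul_factorial_mul_factorial (show a - k ≤ 2 * a by lia)
  rw [show 2 * a - a = a by lia] at hmid
  rw [show 2 * a - (a - k) = a + k by lia, ← hmid, mul_assoc, mul_assoc] at hoff
  rw [← Nat.centralBinom_eq_two_mul_choose] at hoff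
  refine Nat.le_of_mul_le_mul_left ?_ (Nat.centralBinom_pos a)
  rw [sq, ← hoff]
  exact Nat.mul_le_mul_right _ hc

theorem fdCoeff_neg (a : ℕ) (j : ℤ) : fdCoeff a (-j) = fdCoeff a j := by
  simp [fdCoeff]

theorem abs_fdCoeffPos_le {a k : ℕ} (hk : k ≤ a) :
    |fdCoeffPos a k| ≤ 2 * (1 / (k : ℝ) ^ 2) := by
  have hfac : (Nat.factorial a : ℝ) ^ 2 / (Nat.factorial (a - k) * Nat.factorial (a + k)) ≤ 1 := by
    rw [div_le_one (by positivity)]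
    exact_mod_cast factorial_sq_le_factorial_sub_mul_factorial_add hk
  calc |fdCoeffPos a k|
      = 2 * (1 / (k : ℝ) ^ 2) *
          ((Nat.factorial a : ℝ) ^ 2 / (Nat.factorial (a - k) * Nat.factorial (a + k))) := by
        simp only [fdCoeffPos, abs_div, abs_mul, abs_pow, abs_neg, abs_one, one_pow, Nat.abs_cast,
          abs_two]
        ring
    _ ≤ 2 * (1 / (k : ℝ) ^ 2) := mul_le_of_le_one_right (by positivity) hfac

theorem sum_Icc_one_fdCoeff_abs (a : ℕ) :
    ∑ j ∈ Finset.Icc (1 : ℤ) (a : ℤ), |fdCoeff a j| = ∑ k ∈ Finset.Icc 1 a, |fdCoeffPos a k| := by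
  refine Finset.sum_nbij' Int.natAbs (fun k => (k : ℤ)) ?_ ?_ ?_ ?_ ?_
  all_goals intro j hj; rw [Finset.mem_Icc] at hj
  · rw [Finset.mem_Icc]; lia
  · rw [Finset.mem_Icc]; lia
  · lia
  · lia
  · rw [fdCoeff, if_neg (by lia)]

theorem sum_Icc_erase_zero_of_even {f : ℤ → ℝ} (hf : ∀ j, f (-j) = f j) (a : ℕ) :
    ∑ j ∈ (Finset.Icc (-(a : ℤ)) (a : ℤ)).erase 0, f j
      = 2 * ∑ j ∈ Finset.Icc (1 : ℤ) (a : ℤ), f j := by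
  have hpos : ((Finset.Icc (-(a : ℤ)) (a : ℤ)).erase 0).filter (0 < ·) = Finset.Icc 1 (a : ℤ) := by
    ext j
    simp only [Finset.mem_filter, Finset.mem_erase, Finset.mem_Icc]
    lia
  rw [← Finset.sum_filter_add_sum_filter_not _ (0 < ·), hpos, two_mul]
  congr 1
  refine Finset.sum_nbij' (- ·) (- ·) ?_ ?_ ?_ ?_ fun j _ => (hf j).symm
  all_goals
    intro j hj
    simp only [Finset.mem_filter, Finset.mem_erase, Finset.mem_Icc] at hj ⊢
    lia

/-- The sum of the absolute values of the off-center finite-difference coefficients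
satisfies `Σ_{1 ≤ |j| ≤ a} |r_j| = 2 Σ_{j=1}^a |r_j| ≤ 2π²/3`. -/
theorem sum_abs_fdCoeff_offcenter (a : ℕ) (ha : 1 ≤ a) :
    (∑ j ∈ (Finset.Icc (-(a : ℤ)) (a : ℤ)).erase 0, |fdCoeff a j|)
        = 2 * ∑ j ∈ Finset.Icc (1 : ℤ) (a : ℤ), |fdCoeff a j|
    ∧ 2 * ∑ j ∈ Finset.Icc (1 : ℤ) (a : ℤ), |fdCoeff a j| ≤ 2 * Real.pi ^ 2 / 3 := by
  refine ⟨sum_Icc_erase_zero_of_even (fun j => by rw [fdCoeff_neg]) a, ?_⟩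
  have hsum : ∑ k ∈ Finset.Icc 1 a, |fdCoeffPos a k| ≤ 2 * (Real.pi ^ 2 / 6) := calc
    _ ≤ ∑ k ∈ Finset.Icc 1 a, 2 * (1 / (k : ℝ) ^ 2) :=
        Finset.sum_le_sum fun k hk => abs_fdCoeffPos_le (Finset.mem_Icc.mp hk).2
    _ = 2 * ∑ k ∈ Finset.Icc 1 a, 1 / (k : ℝ) ^ 2 := (Finset.mul_sum ..).symm
    _ ≤ 2 * (Real.pi ^ 2 / 6) := by
        gcongr
        exact sum_le_hasSum _ (fun k _ => by positivity) hasSum_zeta_two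
  rw [sum_Icc_one_fdCoeff_abs]
  linarith
end

section
/- Let a ≥ 1, N ≥ 2a+1, let S be the cyclic shift on ℂ^N, let r_{-a},…,r_a be arbitrary real coefficients, and let A ⊆ ZMod N. For B ⊆ ZMod N write Π_B = Σ_{k∈B} e_k e_k^T, R_B = I − 2Π_B, B^c for the complement, and A−j = {k − j mod N : k ∈ A}. Then ½ Σ_{j=-a}^{a} r_j (S^j + S^j R_{A−j}) + ½ (I − R_A) = Π_{A^c} (Σ_{j=-a}^{a} r_j S^j) + Π_A. In particular, this linear combination of shifts and reflections equals the matrix that acts as the periodic finite-difference operator Σ_j r_j S^j on all rows indexed outside A and as the identity on all rows indexed by A. -/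
open Matrix

/-- The orthogonal projector `Π_B = Σ_{k∈B} e_k e_kᵀ` onto the coordinates in `B`. -/
def projOn (N : ℕ) (B : Finset (ZMod N)) : Matrix (ZMod N) (ZMod N) ℂ :=
  Matrix.of fun m n => if m = n ∧ m ∈ B then 1 else 0

/-- The reflection `R_B = I − 2 Π_B` about the coordinates in `B`. -/
def reflOn (N : ℕ) [NeZero N] (B : Finset (ZMod N)) : Matrix (ZMod N) (ZMod N) ℂ :=
  1 - (2 : ℂ) • projOn N B

theorem projOn_eq_diagonal (N : ℕ) (B : Finset (ZMod N)) :
    projOn N B = diagonal fun m => if m ∈ B then 1 else 0 := by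
  ext m n
  by_cases h : m = n <;> simp [projOn, h]

theorem projOn_compl (N : ℕ) [NeZero N] (B : Finset (ZMod N)) :
    projOn N Bᶜ = 1 - projOn N B := by
  ext m n
  by_cases h : m = n <;> by_cases hB : n ∈ B <;> simp [projOn, one_apply, h, hB]

theorem shiftPow_mul_projOn_image_sub (N : ℕ) [NeZero N] (j : ℤ) (A : Finset (ZMod N)) :
    shiftPow N j * projOn N (A.image fun k => k - (j : ZMod N))
      = projOn N A * shiftPow N j := by
  ext m n
  simp only [projOn_eq_diagonal, mul_diagonal, diagonal_mul, shiftPow, of_apply]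
  by_cases h : m = n + (j : ZMod N)
  · simp [h, sub_eq_iff_eq_add]
  · simp [h]

theorem shiftPow_add_shiftPow_mul_reflOn (N : ℕ) [NeZero N] (j : ℤ) (A : Finset (ZMod N)) :
    shiftPow N j + shiftPow N j * reflOn N (A.image fun k => k - (j : ZMod N))
      = (2 : ℂ) • (projOn N Aᶜ * shiftPow N j) := by
  rw [reflOn, projOn_compl, mul_sub, mul_smul_comm, shiftPow_mul_projOn_image_sub, sub_mul,
    mul_one, one_mul]
  module

/-- The linear combination of shifts and reflections
`½ Σ_{j=-a}^a r_j (S^j + S^j R_{A−j}) + ½ (I − R_A)` equals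
`Π_{A^c} (Σ_{j=-a}^a r_j S^j) + Π_A`, i.e. the matrix acting as the periodic
finite-difference operator on rows outside `A` and as the identity on rows in `A`. -/
theorem lcu_boundary_projection (a N : ℕ) [NeZero N] (ha : 1 ≤ a) (hN : 2 * a + 1 ≤ N)
    (r : ℤ → ℝ) (A : Finset (ZMod N)) :
    (1 / 2 : ℂ) • (∑ j ∈ Finset.Icc (-(a : ℤ)) (a : ℤ),
        (r j : ℂ) • (shiftPow N j
          + shiftPow N j * reflOn N (A.image fun k => k - (j : ZMod N))))
      + (1 / 2 : ℂ) • ((1 : Matrix (ZMod N) (ZMod N) ℂ) - reflOn N A)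
    = projOn N Aᶜ * (∑ j ∈ Finset.Icc (-(a : ℤ)) (a : ℤ), (r j : ℂ) • shiftPow N j)
      + projOn N A := by
  simp_rw [shiftPow_add_shiftPow_mul_reflOn, smul_comm _ (2 : ℂ), ← Finset.smul_sum, reflOn,
    Finset.mul_sum, mul_smul_comm]
  module
end

section
/- Polynomial approximation of negative power functions: there exists a universal constant C > 0 with the following property. For all δ, ε ∈ (0, 1/2] and all c > 0, setting f(x) = (δ^c / 2) · x^{−c}, there exist polynomials P, P' ∈ ℝ[x] with P even and P' odd, each of degree at most C · (max(1, c)/δ) · log(1/ε), such that sup_{x ∈ [δ, 1]} |P(x) − f(x)| ≤ ε and sup_{x ∈ [−1, 1]} |P(x)| ≤ 1, and likewise sup_{x ∈ [δ, 1]} |P'(x) − f(x)| ≤ ε and sup_{x ∈ [−1, 1]} |P'(x)| ≤ 1. -/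
open Polynomial
open scoped ENNReal

theorem X_pow_eq_sum_chebyshev (m : ℕ) :
    (X : ℝ[X]) ^ m = C ((1 / 2 : ℝ) ^ m) *
      ∑ k ∈ Finset.range (m + 1), (m.choose k : ℝ[X]) * Chebyshev.T ℝ ((m : ℤ) - 2 * k) := by
  induction m with
  | zero => simp
  | succ m ih =>
    have step (k : ℕ) : 2 * (X : ℝ[X]) * Chebyshev.T ℝ ((m : ℤ) - 2 * k) =
        Chebyshev.T ℝ (((m + 1 : ℕ) : ℤ) - 2 * k) +
        Chebyshev.T ℝ (((m + 1 : ℕ) : ℤ) - 2 * ((k + 1 : ℕ) : ℤ)) := by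
      have h := Chebyshev.T_add_one ℝ ((m : ℤ) - 2 * k)
      have e1 : ((m + 1 : ℕ) : ℤ) - 2 * k = (m : ℤ) - 2 * k + 1 := by push_cast; ring
      have e2 : ((m + 1 : ℕ) : ℤ) - 2 * ((k + 1 : ℕ) : ℤ) = (m : ℤ) - 2 * k - 1 := by
        push_cast; ring
      rw [e1, e2, h]; ring
    have hC : (C ((1 / 2 : ℝ) ^ (m + 1)) : ℝ[X]) * 2 = C ((1 / 2 : ℝ) ^ m) := by
      rw [← C_ofNat, ← C_mul]; congr 1; rw [pow_succ]; ring
    rw [pow_succ, ih, ← hC]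
    have : ∑ k ∈ Finset.range (m + 1 + 1), ((m + 1).choose k : ℝ[X]) *
          Chebyshev.T ℝ (((m + 1 : ℕ) : ℤ) - 2 * k) =
        ∑ k ∈ Finset.range (m + 1), (m.choose k : ℝ[X]) *
          (2 * X * Chebyshev.T ℝ ((m : ℤ) - 2 * k)) := by
      simp_rw [step, mul_add, Finset.sum_add_distrib]
      rw [Finset.sum_range_succ' _ (m + 1)]
      simp_rw [Nat.choose_succ_succ, Nat.cast_add, add_mul, Finset.sum_add_distrib]
      have hs := Finset.sum_range_succ' (fun k : ℕ => (m.choose k : ℝ[X]) *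
          Chebyshev.T ℝ (((m + 1 : ℕ) : ℤ) - 2 * k)) (m + 1)
      rw [Finset.sum_range_succ] at hs
      simp only [Nat.choose_succ_self, Nat.cast_zero, zero_mul, add_zero] at hs
      push_cast at hs ⊢
      rw [hs]
      simp
      ring
    rw [this, Finset.mul_sum, Finset.mul_sum, Finset.sum_mul]
    refine Finset.sum_congr rfl fun k _ => ?_
    ring

theorem exists_natDegree_le_abs_sub_pow_le (m D : ℕ) (l : ℝ) (hl : 0 ≤ l) :
    ∃ p : ℝ[X], p.natDegree ≤ D ∧ ∀ t : ℝ, |t| ≤ 1 →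
      |p.eval t - t ^ m| ≤ 2 * Real.exp (-(l * D) + m * (l ^ 2 / 2)) := by
  classical
  set w : ℕ → ℝ := fun k => (1 / 2 : ℝ) ^ m * m.choose k with hw
  have hw0 : ∀ k, 0 ≤ w k := fun k => by positivity
  have hX (t : ℝ) : t ^ m = ∑ k ∈ Finset.range (m + 1),
      w k * (Chebyshev.T ℝ ((m : ℤ) - 2 * k)).eval t := by
    have := congrArg (eval t) (X_pow_eq_sum_chebyshev m)
    rw [eval_pow, eval_X] at this
    rw [this]
    simp [eval_finsetSum, Finset.mul_sum, hw, mul_assoc]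
  refine ⟨∑ k ∈ (Finset.range (m + 1)).filter (fun k : ℕ => ((m : ℤ) - 2 * k).natAbs ≤ D),
    C (w k) * Chebyshev.T ℝ ((m : ℤ) - 2 * k), ?_, fun t ht => ?_⟩
  · refine natDegree_sum_le_of_forall_le _ _ fun k hk => ?_
    refine (natDegree_C_mul_le _ _).trans ?_
    rw [natDegree_eq_of_degree_eq_some (Chebyshev.degree_T ℝ _)]
    exact (Finset.mem_filter.mp hk).2
  · have e : (eval t (∑ k ∈ (Finset.range (m + 1)).filter
        (fun k : ℕ => ((m : ℤ) - 2 * k).natAbs ≤ D),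
        C (w k) * Chebyshev.T ℝ ((m : ℤ) - 2 * k))) - t ^ m =
        -∑ k ∈ (Finset.range (m + 1)).filter (fun k : ℕ => ¬ ((m : ℤ) - 2 * k).natAbs ≤ D),
          w k * (Chebyshev.T ℝ ((m : ℤ) - 2 * k)).eval t := by
      rw [hX t, ← Finset.sum_filter_add_sum_filter_not (Finset.range (m + 1))
        (fun k : ℕ => ((m : ℤ) - 2 * k).natAbs ≤ D)
        (fun k : ℕ => w k * (Chebyshev.T ℝ ((m : ℤ) - 2 * k)).eval t)]
      simp [eval_finsetSum]
    rw [e, abs_neg]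
    have mgf (s : ℝ) : ∑ k ∈ Finset.range (m + 1), w k * Real.exp (s * ((m : ℝ) - 2 * k)) =
        Real.cosh s ^ m := by
      rw [Real.cosh_eq, add_comm (Real.exp s), div_pow, add_pow, Finset.sum_div]
      refine Finset.sum_congr rfl fun k hk => ?_
      have hkm : k ≤ m := Nat.lt_succ_iff.mp (Finset.mem_range.mp hk)
      rw [← Real.exp_nat_mul, ← Real.exp_nat_mul, ← Real.exp_add, Nat.cast_sub hkm, hw]
      simp only [one_div, inv_pow]
      rw [show s * ((m : ℝ) - 2 * k) = k * -s + (m - k) * s by ring]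
      field_simp
    have hcosh : Real.cosh l ^ m ≤ Real.exp (m * (l ^ 2 / 2)) := by
      rw [Real.exp_nat_mul]
      exact pow_le_pow_left₀ (Real.cosh_pos l).le (Real.cosh_le_exp_half_sq l) m
    calc _ ≤ ∑ k ∈ (Finset.range (m + 1)).filter
          (fun k : ℕ => ¬ ((m : ℤ) - 2 * k).natAbs ≤ D),
            |w k * (Chebyshev.T ℝ ((m : ℤ) - 2 * k)).eval t| := Finset.abs_sum_le_sum_abs _ _
      _ ≤ ∑ k ∈ (Finset.range (m + 1)).filter
          (fun k : ℕ => ¬ ((m : ℤ) - 2 * k).natAbs ≤ D),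
            Real.exp (-(l * D)) * (w k * Real.exp (l * ((m : ℝ) - 2 * k)) +
              w k * Real.exp (-l * ((m : ℝ) - 2 * k))) := by
          refine Finset.sum_le_sum fun k hk => ?_
          have hk2 := (Finset.mem_filter.mp hk).2
          rw [abs_mul, abs_of_nonneg (hw0 k), ← mul_add, mul_left_comm]
          refine mul_le_mul_of_nonneg_left
            ((Chebyshev.abs_eval_T_real_le_one _ ht).trans ?_) (hw0 k)
          have hD : (D : ℝ) ≤ |(m : ℝ) - 2 * k| := by
            have h1 : (D : ℤ) ≤ |(m : ℤ) - 2 * k| := by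
              rw [Int.abs_eq_natAbs]; exact_mod_cast (not_le.mp hk2).le
            exact_mod_cast h1
          rw [mul_add, ← Real.exp_add, ← Real.exp_add]
          rcases le_abs.mp hD with h | h
          · have : 0 ≤ -(l * D) + l * ((m : ℝ) - 2 * k) := by nlinarith
            linarith [Real.one_le_exp this, Real.exp_pos (-(l * D) + -l * ((m : ℝ) - 2 * k))]
          · have : 0 ≤ -(l * D) + -l * ((m : ℝ) - 2 * k) := by nlinarith
            linarith [Real.one_le_exp this, Real.exp_pos (-(l * D) + l * ((m : ℝ) - 2 * k))]
      _ ≤ ∑ k ∈ Finset.range (m + 1),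
            Real.exp (-(l * D)) * (w k * Real.exp (l * ((m : ℝ) - 2 * k)) +
              w k * Real.exp (-l * ((m : ℝ) - 2 * k))) :=
          Finset.sum_le_sum_of_subset_of_nonneg (Finset.filter_subset _ _) fun k _ _ => by
            have := hw0 k
            positivity
      _ = Real.exp (-(l * D)) * (2 * Real.cosh l ^ m) := by
          rw [← Finset.mul_sum, Finset.sum_add_distrib, mgf, mgf, Real.cosh_neg]; ring
      _ ≤ Real.exp (-(l * D)) * (2 * Real.exp (m * (l ^ 2 / 2))) := by gcongr
      _ = _ := by rw [Real.exp_add]; ring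

theorem exists_amplifier (n : ℕ) :
    ∃ A : ℝ[X], A.natDegree ≤ n ∧ ∀ y ∈ Set.Icc (0 : ℝ) 1,
      0 ≤ A.eval y ∧ A.eval y ≤ 1 ∧ (y ≤ 19 / 40 → A.eval y ≤ (799 / 800) ^ n) ∧
      (21 / 40 ≤ y → 1 - A.eval y ≤ (799 / 800) ^ n) := by
  classical
  refine ⟨∑ k ∈ (Finset.range (n + 1)).filter (fun k => n < 2 * k),
    C (n.choose k : ℝ) * (X ^ k * (1 - X) ^ (n - k)), ?_, fun y hy => ?_⟩
  · refine natDegree_sum_le_of_forall_le _ _ fun k hk => ?_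
    have hkn : k ≤ n := Nat.lt_succ_iff.mp (Finset.mem_range.mp (Finset.mem_filter.mp hk).1)
    refine (natDegree_C_mul_le _ _).trans (natDegree_mul_le.trans ?_)
    have h1 : ((1 - X : ℝ[X]) ^ (n - k)).natDegree ≤ (n - k) * 1 :=
      natDegree_pow_le_of_le _ ((natDegree_sub_le _ _).trans (by simp))
    rw [natDegree_X_pow]; omega
  · obtain ⟨hy0, hy1⟩ := hy
    set u : ℕ → ℝ := fun k => n.choose k * (y ^ k * (1 - y) ^ (n - k)) with hu
    have hu0 : ∀ k, 0 ≤ u k := fun k => by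
      have : 0 ≤ 1 - y := by linarith
      positivity
    have ev : eval y (∑ k ∈ (Finset.range (n + 1)).filter (fun k => n < 2 * k),
        C (n.choose k : ℝ) * (X ^ k * (1 - X) ^ (n - k))) =
        ∑ k ∈ (Finset.range (n + 1)).filter (fun k => n < 2 * k), u k := by
      simp [eval_finsetSum, hu]
    have hmu (a b : ℝ) : ∑ k ∈ Finset.range (n + 1), u k * (a ^ k * b ^ (n - k)) =
        (y * a + (1 - y) * b) ^ n := by
      rw [add_pow]
      refine Finset.sum_congr rfl fun k _ => ?_
      rw [hu, mul_pow, mul_pow]; ring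
    have tot : ∑ k ∈ (Finset.range (n + 1)).filter (fun k => n < 2 * k), u k +
        ∑ k ∈ (Finset.range (n + 1)).filter (fun k => ¬ n < 2 * k), u k = 1 := by
      rw [Finset.sum_filter_add_sum_filter_not]
      simpa using hmu 1 1
    have p1 : 0 ≤ ∑ k ∈ (Finset.range (n + 1)).filter (fun k => n < 2 * k), u k :=
      Finset.sum_nonneg fun k _ => hu0 k
    have p2 : 0 ≤ ∑ k ∈ (Finset.range (n + 1)).filter (fun k => ¬ n < 2 * k), u k :=
      Finset.sum_nonneg fun k _ => hu0 k
    have tail (S : Finset ℕ) (hS : S ⊆ Finset.range (n + 1)) (a b : ℝ) (ha : 0 ≤ a) (hb : 0 ≤ b)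
        (h : ∀ k ∈ S, 1 ≤ a ^ k * b ^ (n - k)) :
        ∑ k ∈ S, u k ≤ (y * a + (1 - y) * b) ^ n := by
      rw [← hmu]
      refine (Finset.sum_le_sum fun k hk => ?_).trans
        (Finset.sum_le_sum_of_subset_of_nonneg hS fun k _ _ => ?_)
      · exact le_mul_of_one_le_right (hu0 k) (h k hk)
      · have := hu0 k
        positivity
    have key (i j : ℕ) (hij : i ≤ j) : (1 : ℝ) ≤ (21 / 20) ^ j * (20 / 21) ^ i := by
      obtain ⟨d, rfl⟩ := Nat.exists_eq_add_of_le hij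
      rw [pow_add, mul_right_comm, ← mul_pow]
      norm_num
      exact one_le_pow₀ (by norm_num)
    rw [ev]
    refine ⟨p1, by linarith, fun h => ?_, fun h => ?_⟩
    · refine (tail _ (Finset.filter_subset _ _) (21 / 20) (20 / 21) (by norm_num) (by norm_num)
        fun k hk => key _ _ ?_).trans ?_
      · have := (Finset.mem_filter.mp hk).2; omega
      · exact pow_le_pow_left₀ (by nlinarith) (by linarith) n
    · have e : 1 - ∑ k ∈ (Finset.range (n + 1)).filter (fun k => n < 2 * k), u k =
        ∑ k ∈ (Finset.range (n + 1)).filter (fun k => ¬ n < 2 * k), u k := by linarith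
      rw [e]
      refine (tail _ (Finset.filter_subset _ _) (20 / 21) (21 / 20) (by norm_num) (by norm_num)
        fun k hk => ?_).trans ?_
      · rw [mul_comm]; refine key _ _ ?_
        have := (Finset.mem_filter.mp hk).2; omega
      · exact pow_le_pow_left₀ (by nlinarith) (by linarith) n

/-- `F` is given on `[0, 1)` by a power series with nonnegative coefficients. -/
def HasNonnegSeries (F : ℝ → ℝ≥0∞) : Prop :=
  ∃ b : ℕ → ℝ≥0∞, ∀ q ∈ Set.Ico (0 : ℝ) 1, F q = ∑' m, b m * ENNReal.ofReal q ^ m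

namespace HasNonnegSeries

theorem one : HasNonnegSeries 1 := by
  refine ⟨fun m => if m = 0 then 1 else 0, fun q _ => ?_⟩
  rw [tsum_eq_single 0 fun m hm => by simp [hm]]
  simp

theorem mul {F G : ℝ → ℝ≥0∞} (hF : HasNonnegSeries F) (hG : HasNonnegSeries G) :
    HasNonnegSeries (F * G) := by
  obtain ⟨b, hb⟩ := hF
  obtain ⟨c, hc⟩ := hG
  refine ⟨fun k => ∑' m, ∑' n, if m + n = k then b m * c n else 0, fun q hq => ?_⟩
  have expand (k : ℕ) : (∑' m, ∑' n, if m + n = k then b m * c n else 0) * ENNReal.ofReal q ^ k =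
      ∑' m, ∑' n, if m + n = k then b m * c n * ENNReal.ofReal q ^ k else 0 := by
    simp_rw [← ENNReal.tsum_mul_right, ite_mul, zero_mul]
  calc (F * G) q = ∑' m, ∑' n, b m * c n * ENNReal.ofReal q ^ (m + n) := by
        rw [Pi.mul_apply, hb q hq, hc q hq, ← ENNReal.tsum_mul_right]
        refine tsum_congr fun m => ?_
        rw [← ENNReal.tsum_mul_left]
        exact tsum_congr fun n => by ring
    _ = ∑' m, ∑' n, ∑' k, if m + n = k then b m * c n * ENNReal.ofReal q ^ k else 0 := by
        refine tsum_congr fun m => tsum_congr fun n => ?_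
        rw [tsum_eq_single (m + n) fun k hk => by rw [if_neg hk.symm], if_pos rfl]
    _ = ∑' k, ∑' m, ∑' n, if m + n = k then b m * c n * ENNReal.ofReal q ^ k else 0 := by
        rw [ENNReal.tsum_comm]
        conv_rhs => rw [ENNReal.tsum_comm]
        conv_lhs => rw [ENNReal.tsum_comm]
        exact tsum_congr fun m => ENNReal.tsum_comm
    _ = _ := tsum_congr fun k => (expand k).symm

theorem pow {F : ℝ → ℝ≥0∞} (hF : HasNonnegSeries F) (k : ℕ) : HasNonnegSeries (F ^ k) := by
  induction k with
  | zero => simpa using one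
  | succ k ih => rw [pow_succ]; exact ih.mul hF

theorem comp {F : ℝ → ℝ≥0∞} (hF : HasNonnegSeries F) (w : ℕ → ℝ≥0∞) :
    HasNonnegSeries fun q => ∑' k, w k * F q ^ k := by
  choose b hb using fun k => hF.pow k
  refine ⟨fun m => ∑' k, w k * b k m, fun q hq => ?_⟩
  simp_rw [← ENNReal.tsum_mul_right]
  rw [ENNReal.tsum_comm]
  refine tsum_congr fun k => ?_
  have := hb k q hq
  rw [Pi.pow_apply] at this
  rw [this, ← ENNReal.tsum_mul_left]
  exact tsum_congr fun m => (mul_assoc _ _ _).symm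

theorem exists_hasSum {f : ℝ → ℝ} (hf : ∀ q ∈ Set.Ico (0 : ℝ) 1, 0 ≤ f q)
    (h : HasNonnegSeries fun q => ENNReal.ofReal (f q)) :
    ∃ b : ℕ → ℝ, (∀ m, 0 ≤ b m) ∧ ∀ q ∈ Set.Ico (0 : ℝ) 1, HasSum (fun m => b m * q ^ m) (f q) := by
  obtain ⟨b, hb⟩ := h
  have hfin (q : ℝ) (hq : q ∈ Set.Ico (0 : ℝ) 1) : ∑' m, b m * ENNReal.ofReal q ^ m ≠ ∞ := by
    rw [← hb q hq]; exact ENNReal.ofReal_ne_top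
  refine ⟨fun m => (b m).toReal, fun m => ENNReal.toReal_nonneg, fun q hq => ?_⟩
  have := ENNReal.hasSum_toReal (hfin q hq)
  rw [← ENNReal.tsum_toReal_eq (ENNReal.ne_top_of_tsum_ne_top (hfin q hq)), ← hb q hq,
    ENNReal.toReal_ofReal (hf q hq)] at this
  simpa [ENNReal.toReal_ofReal hq.1] using this

end HasNonnegSeries

theorem hasSum_one_sub_rpow_neg (c x : ℝ) (hx : x ∈ Set.Ico (0 : ℝ) 1) :
    HasSum (fun n : ℕ => Ring.choose (c + n - 1) n * x ^ n) ((1 - x) ^ (-c)) := by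
  have h := (Real.one_div_one_sub_rpow_hasFPowerSeriesOnBall_zero c).hasSum (y := x)
    (by simpa [Real.enorm_eq_ofReal hx.1] using hx.2)
  simpa [mul_comm, FormalMultilinearSeries.ofScalars_apply_eq,
    Real.rpow_neg (sub_nonneg.mpr hx.2.le)] using h

theorem factorial_mul_choose_add_sub_one (c : ℝ) (n : ℕ) :
    (n.factorial : ℝ) * Ring.choose (c + n - 1) n = ∏ i ∈ Finset.range n, (c + i) := by
  rw [← Ring.multichoose_eq, ← nsmul_eq_mul, Ring.factorial_nsmul_multichoose_eq_ascPochhammer,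
    Polynomial.ascPochhammer_smeval_eq_eval]
  induction n with
  | zero => simp
  | succ n ih => rw [ascPochhammer_succ_eval, ih, Finset.prod_range_succ]

theorem hasNonnegSeries_one_sub_sqrt :
    HasNonnegSeries fun q => ENNReal.ofReal (1 - √(1 - q)) := by
  set b : ℕ → ℝ := fun n => Ring.choose ((-(1 / 2) : ℝ) + n - 1) n with hb
  have hbneg (n : ℕ) : b (n + 1) ≤ 0 := by
    have h := factorial_mul_choose_add_sub_one (-(1 / 2)) (n + 1)
    rw [Finset.prod_range_succ'] at h
    have h1 : 0 ≤ ∏ k ∈ Finset.range n, (-(1 / 2 : ℝ) + ((k + 1 : ℕ) : ℝ)) :=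
      Finset.prod_nonneg fun k _ => by push_cast; linarith [(Nat.cast_nonneg k : (0 : ℝ) ≤ k)]
    have h2 : (0 : ℝ) < (n + 1).factorial := by positivity
    by_contra! hcon
    have h3 : 0 < ((n + 1).factorial : ℝ) * b (n + 1) := mul_pos h2 hcon
    rw [hb] at h3
    dsimp only at h3
    rw [h] at h3
    generalize ∏ k ∈ Finset.range n, (-(1 / 2 : ℝ) + ((k + 1 : ℕ) : ℝ)) = P at h1 h3
    rw [Nat.cast_zero] at h3
    linarith
  have hb0 : b 0 = 1 := by simp [hb]
  refine ⟨fun m => if m = 0 then 0 else ENNReal.ofReal (-b m), fun q hq => ?_⟩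
  have hs := hasSum_one_sub_rpow_neg (-(1 / 2)) q hq
  rw [neg_neg, ← Real.sqrt_eq_rpow] at hs
  have hs' : HasSum (fun n => -b (n + 1) * q ^ (n + 1)) (1 - √(1 - q)) := by
    have := ((hasSum_nat_add_iff' 1).mpr hs).neg
    simp only [Finset.range_one, Finset.sum_singleton, pow_zero, mul_one] at this
    rw [show Ring.choose (-(1 / 2 : ℝ) + (0 : ℕ) - 1) 0 = 1 from hb0, neg_sub] at this
    simpa only [hb, neg_mul] using this
  rw [tsum_eq_zero_add' ENNReal.summable]
  simp only [if_true, zero_mul, zero_add, Nat.add_eq_zero_iff, one_ne_zero, and_false, if_false]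
  rw [← hs'.tsum_eq, ENNReal.ofReal_tsum_of_nonneg _ hs'.summable]
  · refine tsum_congr fun n => ?_
    rw [ENNReal.ofReal_mul (neg_nonneg.mpr (hbneg n)), ENNReal.ofReal_pow hq.1]
  · exact fun n => mul_nonneg (neg_nonneg.mpr (hbneg n)) (pow_nonneg hq.1 _)

/-- The function `q ↦ (a + 2 √(1 - q)) ^ (-c)` has nonnegative Taylor coefficients at `0`. -/
theorem exists_hasSum_add_sqrt_rpow_neg {a c : ℝ} (ha : 0 < a) (hc : 0 < c) :
    ∃ b : ℕ → ℝ, (∀ m, 0 ≤ b m) ∧ ∀ q ∈ Set.Ico (0 : ℝ) 1,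
      HasSum (fun m => b m * q ^ m) ((a + 2 * √(1 - q)) ^ (-c)) := by
  refine HasNonnegSeries.exists_hasSum (fun q _ => by positivity) ?_
  set w : ℕ → ℝ := fun k => (a + 2) ^ (-c) * (Ring.choose (c + k - 1) k * (2 / (a + 2)) ^ k) with hw
  have hw0 (k : ℕ) : 0 ≤ w k := by
    have h1 := factorial_mul_choose_add_sub_one c k
    have h2 : 0 ≤ ∏ i ∈ Finset.range k, (c + i) := Finset.prod_nonneg fun i _ => by positivity
    rw [← h1] at h2
    have h3 := nonneg_of_mul_nonneg_right h2 (by positivity)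
    positivity
  obtain ⟨b, hb⟩ := hasNonnegSeries_one_sub_sqrt.comp fun k => ENNReal.ofReal (w k)
  refine ⟨b, fun q hq => ?_⟩
  rw [← hb q hq]
  have hs0 : 0 ≤ √(1 - q) := Real.sqrt_nonneg _
  have hs1 : √(1 - q) ≤ 1 := Real.sqrt_le_one.mpr (by linarith [hq.1])
  have h := (hasSum_one_sub_rpow_neg c (2 / (a + 2) * (1 - √(1 - q)))
    ⟨mul_nonneg (by positivity) (by linarith), by
      rw [div_mul_eq_mul_div, div_lt_one (by positivity)]; linarith⟩).mul_left ((a + 2) ^ (-c))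
  rw [← Real.mul_rpow (by positivity)
    (by rw [sub_nonneg, div_mul_eq_mul_div, div_le_one (by positivity)]; linarith)] at h
  have e : (a + 2) * (1 - 2 / (a + 2) * (1 - √(1 - q))) = a + 2 * √(1 - q) := by
    field_simp; ring
  have e2 (k : ℕ) : (a + 2) ^ (-c) * (Ring.choose (c + k - 1) k *
      (2 / (a + 2) * (1 - √(1 - q))) ^ k) = w k * (1 - √(1 - q)) ^ k := by
    rw [hw, mul_pow]; ring
  rw [e, funext e2] at h
  beta_reduce
  rw [← h.tsum_eq, ENNReal.ofReal_tsum_of_nonneg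
    (fun k => mul_nonneg (hw0 k) (pow_nonneg (by linarith) k)) h.summable]
  refine tsum_congr fun k => ?_
  rw [ENNReal.ofReal_mul (hw0 k), ENNReal.ofReal_pow (by linarith)]

theorem half_le_log_one_div {ε : ℝ} (hε : ε ∈ Set.Ioc (0 : ℝ) (1 / 2)) :
    1 / 2 ≤ Real.log (1 / ε) := by
  have h1 : Real.log 2 ≤ Real.log (1 / ε) :=
    Real.log_le_log (by norm_num) (by rw [le_div_iff₀ hε.1]; linarith [hε.2])
  linarith [Real.log_two_gt_d9]

theorem exp_neg_log_one_div {ε : ℝ} (hε : 0 < ε) : Real.exp (-Real.log (1 / ε)) = ε := by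
  rw [one_div, Real.log_inv, neg_neg, Real.exp_log hε]

/-- A function given on `[0, 1)` by a power series with nonnegative coefficients of bounded sum
has polynomial approximations on `[0, 1 - γ ^ 2]` of degree `O(log (1 / ε) / γ)` that stay bounded
on `[0, 1]`. -/
theorem exists_approx_of_nonneg_series {b : ℕ → ℝ} {f : ℝ → ℝ} {B γ ε : ℝ} (hb : ∀ m, 0 ≤ b m)
    (hf : ∀ q ∈ Set.Ico (0 : ℝ) 1, HasSum (fun m => b m * q ^ m) (f q))
    (hB : ∀ q ∈ Set.Ico (0 : ℝ) 1, f q ≤ B) (hγ : γ ∈ Set.Ioc (0 : ℝ) 1)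
    (hε : ε ∈ Set.Ioc (0 : ℝ) (1 / 2)) :
    ∃ p : ℝ[X], (p.natDegree : ℝ) ≤ 4 * Real.log (1 / ε) / γ + 1 ∧
      (∀ t ∈ Set.Icc (0 : ℝ) 1, |p.eval t| ≤ B + 2 * B * ε) ∧
      ∀ t ∈ Set.Icc (0 : ℝ) (1 - γ ^ 2), |p.eval t - f t| ≤ 3 * B * ε := by
  obtain ⟨hγ0, hγ1⟩ := hγ
  set L := Real.log (1 / ε) with hL
  have hL2 : 1 / 2 ≤ L := half_le_log_one_div hε
  have hexp : Real.exp (-L) = ε := exp_neg_log_one_div hε.1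
  set N := ⌈L / γ ^ 2⌉₊ with hN
  set D := ⌈4 * L / γ⌉₊ with hD
  have hN1 : L ≤ N * γ ^ 2 := by
    rw [← div_le_iff₀ (by positivity)]; exact Nat.le_ceil _
  have hN2 : N * γ ^ 2 ≤ L + γ ^ 2 := by
    have := (Nat.ceil_lt_add_one (show 0 ≤ L / γ ^ 2 by positivity)).le
    calc _ ≤ (L / γ ^ 2 + 1) * γ ^ 2 := by gcongr
      _ = _ := by field_simp
  have hD1 : 4 * L ≤ γ * D := by
    rw [mul_comm γ, ← div_le_iff₀ hγ0]; exact Nat.le_ceil _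
  have hpart (n : ℕ) : ∑ m ∈ Finset.range n, b m ≤ B := by
    have hlim : Filter.Tendsto (fun q : ℝ => ∑ m ∈ Finset.range n, b m * q ^ m)
        (nhdsWithin 1 (Set.Iio 1)) (nhds (∑ m ∈ Finset.range n, b m * (1 : ℝ) ^ m)) :=
      (Continuous.tendsto (by fun_prop) 1).mono_left nhdsWithin_le_nhds
    simp only [one_pow, mul_one] at hlim
    refine le_of_tendsto hlim ?_
    filter_upwards [Ico_mem_nhdsLT (show (0 : ℝ) < 1 by norm_num)] with q hq
    exact (sum_le_hasSum _ (fun m _ => mul_nonneg (hb m) (pow_nonneg hq.1 m)) (hf q hq)).trans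
      (hB q hq)
  have hBsum : Summable b := summable_of_sum_range_le hb hpart
  have hB0 : 0 ≤ B := by simpa using hpart 0
  choose p hpD hp using fun m => exists_natDegree_le_abs_sub_pow_le m D γ hγ0.le
  have hp' (m : ℕ) (hm : m < N) (t : ℝ) (ht : |t| ≤ 1) : |(p m).eval t - t ^ m| ≤ 2 * ε := by
    refine (hp m t ht).trans ?_
    rw [← hexp]
    gcongr
    have : (m : ℝ) * (γ ^ 2 / 2) ≤ N * (γ ^ 2 / 2) := by gcongr
    nlinarith
  have herr (t : ℝ) (ht : |t| ≤ 1) : |(∑ m ∈ Finset.range N, C (b m) * p m).eval t -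
      ∑ m ∈ Finset.range N, b m * t ^ m| ≤ 2 * B * ε := by
    rw [eval_finsetSum, ← Finset.sum_sub_distrib]
    calc _ ≤ ∑ m ∈ Finset.range N, |(C (b m) * p m).eval t - b m * t ^ m| :=
          Finset.abs_sum_le_sum_abs _ _
      _ ≤ ∑ m ∈ Finset.range N, b m * (2 * ε) := by
          refine Finset.sum_le_sum fun m hm => ?_
          rw [eval_mul, eval_C, ← mul_sub, abs_mul, abs_of_nonneg (hb m)]
          exact mul_le_mul_of_nonneg_left (hp' m (Finset.mem_range.mp hm) t ht) (hb m)
      _ ≤ B * (2 * ε) := by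
          rw [← Finset.sum_mul]
          exact mul_le_mul_of_nonneg_right (hpart N) (by linarith [hε.1])
      _ = _ := by ring
  refine ⟨∑ m ∈ Finset.range N, C (b m) * p m, ?_, fun t ht => ?_, fun t ht => ?_⟩
  · refine le_trans ?_ (Nat.ceil_lt_add_one (show 0 ≤ 4 * L / γ by positivity)).le
    exact_mod_cast natDegree_sum_le_of_forall_le _ _ fun m _ =>
      (natDegree_C_mul_le _ _).trans (hpD m)
  · have h1 := abs_le.mp (herr t (by rw [abs_of_nonneg ht.1]; exact ht.2))
    have h2 : ∑ m ∈ Finset.range N, b m * t ^ m ≤ B :=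
      (Finset.sum_le_sum fun m _ =>
        mul_le_of_le_one_right (hb m) (pow_le_one₀ ht.1 ht.2)).trans (hpart N)
    have h3 : 0 ≤ ∑ m ∈ Finset.range N, b m * t ^ m :=
      Finset.sum_nonneg fun m _ => mul_nonneg (hb m) (pow_nonneg ht.1 m)
    rw [abs_le]; constructor <;> linarith
  · have ht1 : t < 1 := by nlinarith [ht.2]
    have h1 := abs_le.mp (herr t (by rw [abs_of_nonneg ht.1]; exact ht1.le))
    have hs := hf t ⟨ht.1, ht1⟩
    have h2 : ∑ m ∈ Finset.range N, b m * t ^ m ≤ f t :=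
      sum_le_hasSum _ (fun m _ => mul_nonneg (hb m) (pow_nonneg ht.1 m)) hs
    have htN : t ^ N ≤ ε := by
      rw [← hexp]
      calc t ^ N ≤ Real.exp (-γ ^ 2) ^ N := by
            refine pow_le_pow_left₀ ht.1 ?_ N
            linarith [ht.2, Real.add_one_le_exp (-γ ^ 2)]
        _ = Real.exp (N * -γ ^ 2) := (Real.exp_nat_mul _ _).symm
        _ ≤ _ := Real.exp_le_exp.mpr (by linarith)
    have h3 : f t - ∑ m ∈ Finset.range N, b m * t ^ m ≤ B * ε := by
      have ha := (hasSum_nat_add_iff' N).mpr hs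
      have hbN : Summable fun m => b (m + N) * ε := ((summable_nat_add_iff N).mpr hBsum).mul_right ε
      have hle : ∑' m, b (m + N) * ε ≤ B * ε := by
        rw [tsum_mul_right]
        refine mul_le_mul_of_nonneg_right ?_ hε.1.le
        refine Summable.tsum_le_of_sum_range_le ((summable_nat_add_iff N).mpr hBsum) fun n => ?_
        have := hpart (N + n)
        rw [Finset.sum_range_add] at this
        have h0 : 0 ≤ ∑ m ∈ Finset.range N, b m := Finset.sum_nonneg fun m _ => hb m
        simp_rw [add_comm _ N]
        linarith
      refine (hasSum_le (fun m => ?_) ha hbN.hasSum).trans hle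
      refine mul_le_mul_of_nonneg_left ?_ (hb _)
      rw [pow_add]
      exact (mul_le_of_le_one_left (pow_nonneg ht.1 N) (pow_le_one₀ ht.1 ht1.le)).trans htN
    have hBε : 0 ≤ B * ε := mul_nonneg hB0 hε.1.le
    rw [abs_le]; constructor <;> linarith

theorem exists_antiderivative (K : ℝ[X]) :
    ∃ F : ℝ[X], derivative F = K ∧ F.natDegree ≤ K.natDegree + 1 := by
  refine ⟨∑ k ∈ Finset.range (K.natDegree + 1), C (K.coeff k / (k + 1)) * X ^ (k + 1), ?_, ?_⟩
  · conv_rhs => rw [K.as_sum_range_C_mul_X_pow]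
    rw [derivative_sum]
    refine Finset.sum_congr rfl fun k _ => ?_
    rw [derivative_C_mul_X_pow]
    have : ((k : ℝ) + 1) ≠ 0 := by positivity
    congr 2
    push_cast
    field_simp
  · refine natDegree_sum_le_of_forall_le _ _ fun k hk => ?_
    refine (natDegree_C_mul_X_pow_le _ _).trans ?_
    have := Finset.mem_range.mp hk
    omega

theorem exists_bump_polynomial (j : ℕ) :
    ∃ K : ℝ[X], K.natDegree ≤ 8 * j ∧ (∀ t : ℝ, 0 ≤ K.eval t) ∧
      ∀ t ∈ Set.Ioc (0 : ℝ) 1, K.eval (-t) = K.eval t ∧ K.eval t ≤ 1 / t ^ 2 ∧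
        K.eval t ≤ 4 * (4 * j + 1) ^ 2 ∧
        (t ≤ 1 / (4 * j + 1) → (4 * j + 1) ^ 2 / 4 ≤ K.eval t) := by
  set T := Chebyshev.T ℝ (4 * j + 1) with hT
  have hodd : Odd ((4 : ℤ) * j + 1) := ⟨2 * j, by ring⟩
  have hmul (t : ℝ) : T.divX.eval t * t = T.eval t := by
    have h := congrArg (eval t) T.divX_mul_X_add
    have h0 : T.coeff 0 = 0 := by
      rw [coeff_zero_eq_eval_zero]; exact Chebyshev.T_eval_zero_of_odd ℝ hodd
    simpa [h0] using h
  refine ⟨T.divX ^ 2, ?_, fun t => by rw [eval_pow]; positivity, fun t ht => ?_⟩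
  · refine (natDegree_pow_le_of_le 2 (show T.divX.natDegree ≤ 4 * j from ?_)).trans (by omega)
    rw [natDegree_divX_eq_natDegree_tsub_one,
      natDegree_eq_of_degree_eq_some (Chebyshev.degree_T ℝ _)]
    omega
  · obtain ⟨ht0, ht1⟩ := ht
    simp only [eval_pow]
    set n : ℝ := 4 * j + 1 with hn
    have hn1 : 1 ≤ n := by rw [hn]; linarith [(Nat.cast_nonneg j : (0 : ℝ) ≤ j)]
    have hneg : T.divX.eval (-t) = T.divX.eval t := by
      have h1 := hmul (-t)
      rw [hT, Chebyshev.T_eval_neg, Int.negOnePow_odd _ hodd, ← hT, ← hmul t] at h1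
      simp only [Units.val_neg, Units.val_one, Int.cast_neg, Int.cast_one] at h1
      have : t * (T.divX.eval (-t) - T.divX.eval t) = 0 := by linarith
      rcases mul_eq_zero.mp this with h | h <;> linarith
    set θ := Real.arcsin t with hθ
    have hsin : Real.sin θ = t := Real.sin_arcsin (by linarith) ht1
    have hθ0 : 0 ≤ θ := Real.arcsin_nonneg.mpr ht0.le
    have hθ1 : θ ≤ Real.pi / 2 := Real.arcsin_le_pi_div_two t
    have hTs : T.eval t = Real.sin (n * θ) := by
      rw [← hsin, ← Real.cos_pi_div_two_sub, hT, Chebyshev.T_real_cos]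
      rw [← Real.cos_pi_div_two_sub, ← Real.cos_add_nat_mul_two_pi (Real.pi / 2 - n * θ) j]
      congr 1
      rw [hn]; push_cast; ring
    have htθ : t ≤ θ := hsin ▸ Real.sin_le hθ0
    have hθt : θ ≤ Real.pi / 2 * t := by
      have := Real.mul_le_sin hθ0 hθ1
      rw [hsin] at this
      have hpi := Real.pi_pos
      calc θ = Real.pi / 2 * (2 / Real.pi * θ) := by field_simp
        _ ≤ _ := by gcongr
    have hv : T.divX.eval t = Real.sin (n * θ) / t := by
      rw [eq_div_iff ht0.ne', hmul, hTs]
    rw [hneg, hv]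
    refine ⟨rfl, ?_, ?_, fun htn => ?_⟩
    · rw [div_pow]
      gcongr
      exact Real.sin_sq_le_one _
    · rw [show 4 * n ^ 2 = (2 * n) ^ 2 by ring, ← sq_abs, abs_div, abs_of_pos ht0]
      gcongr
      rw [div_le_iff₀ ht0]
      calc |Real.sin (n * θ)| ≤ |n * θ| := Real.abs_sin_le_abs
        _ = n * θ := abs_of_nonneg (by positivity)
        _ ≤ n * (2 * t) := by
          gcongr
          nlinarith [Real.pi_le_four]
        _ = _ := by ring
    · rw [show n ^ 2 / 4 = (n / 2) ^ 2 by ring]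
      refine pow_le_pow_left₀ (by positivity) ?_ 2
      rw [le_div_iff₀ ht0]
      rw [le_div_iff₀ (by linarith)] at htn
      have hpi := Real.pi_pos
      have h1 : n * θ ≤ Real.pi / 2 := by
        calc n * θ ≤ n * (Real.pi / 2 * t) := by gcongr
          _ = Real.pi / 2 * (t * n) := by ring
          _ ≤ Real.pi / 2 * 1 := by gcongr
          _ = _ := mul_one _
      refine le_trans ?_ (Real.mul_le_sin (by positivity) h1)
      calc n / 2 * t = 1 / 2 * (n * t) := by ring
        _ ≤ 2 / Real.pi * (n * θ) := by
          refine mul_le_mul ?_ (by gcongr) (by positivity) (by positivity)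
          rw [div_le_div_iff₀ (by norm_num) hpi]
          linarith [Real.pi_le_four]

/-- A crude polynomial step: it separates `[-1, -1 / n]` from `[1 / n, 1]` by a constant gap,
with degree `O(n)`. -/
theorem exists_crude_step (j : ℕ) :
    ∃ V : ℝ[X], V.natDegree ≤ 8 * j + 1 ∧ ∀ x ∈ Set.Icc (-1 : ℝ) 1,
      V.eval x ∈ Set.Icc (0 : ℝ) 1 ∧ (1 / (4 * j + 1) ≤ x → 21 / 40 ≤ V.eval x) ∧
      (x ≤ -(1 / (4 * j + 1)) → V.eval x ≤ 19 / 40) := by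
  obtain ⟨K, hKd, hK0, hK⟩ := exists_bump_polynomial j
  obtain ⟨F, hFK, hFd⟩ := exists_antiderivative K
  set n : ℝ := 4 * j + 1 with hn
  have hn1 : 1 ≤ n := by rw [hn]; linarith [(Nat.cast_nonneg j : (0 : ℝ) ≤ j)]
  have hn0 : 0 < n := by linarith
  have hni : 1 / n ≤ 1 := by rw [div_le_one hn0]; exact hn1
  have hni0 : 0 < 1 / n := by positivity
  set W : ℝ[X] := F - F.comp (-X) with hW
  have hWeval (x : ℝ) : W.eval x = F.eval x - F.eval (-x) := by simp [hW]
  have hW0 : W.eval 0 = 0 := by simp [hWeval]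
  have hWneg (x : ℝ) : W.eval (-x) = -W.eval x := by rw [hWeval, hWeval, neg_neg]; ring
  have hderiv (x : ℝ) : deriv (fun x => W.eval x) x = K.eval x + K.eval (-x) := by
    rw [Polynomial.deriv, hW, derivative_sub, derivative_comp, hFK]
    simp
  have hmono : Monotone fun x => W.eval x :=
    monotone_of_deriv_nonneg W.differentiable fun x => by
      rw [hderiv]; exact add_nonneg (hK0 _) (hK0 _)
  have hderiv' (x : ℝ) (hx : x ∈ Set.Ioc (0 : ℝ) 1) :
      deriv (fun x => W.eval x) x = 2 * K.eval x := by
    rw [hderiv, (hK x hx).1]; ring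
  have hlow : n / 2 ≤ W.eval (1 / n) := by
    have := (convex_Icc (0 : ℝ) (1 / n)).mul_sub_le_image_sub_of_le_deriv
      (f := fun x => W.eval x) (C := n ^ 2 / 2) W.continuous.continuousOn
      W.differentiable.differentiableOn (fun x hx => by
        rw [interior_Icc] at hx
        have hx' : x ∈ Set.Ioc (0 : ℝ) 1 := ⟨hx.1, hx.2.le.trans hni⟩
        rw [hderiv' x hx']
        linarith [(hK x hx').2.2.2 hx.2.le]) 0 ⟨le_rfl, hni0.le⟩ (1 / n) ⟨hni0.le, le_rfl⟩ hni0.le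
    simp only [hW0, sub_zero] at this
    refine le_trans (le_of_eq ?_) this
    field_simp
  have hup : W.eval (1 / n) ≤ 8 * n := by
    have := (convex_Icc (0 : ℝ) (1 / n)).image_sub_le_mul_sub_of_deriv_le
      (f := fun x => W.eval x) (C := 8 * n ^ 2) W.continuous.continuousOn
      W.differentiable.differentiableOn (fun x hx => by
        rw [interior_Icc] at hx
        have hx' : x ∈ Set.Ioc (0 : ℝ) 1 := ⟨hx.1, hx.2.le.trans hni⟩
        rw [hderiv' x hx']
        linarith [(hK x hx').2.2.1]) 0 ⟨le_rfl, hni0.le⟩ (1 / n) ⟨hni0.le, le_rfl⟩ hni0.le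
    simp only [hW0, sub_zero] at this
    refine this.trans (le_of_eq ?_)
    field_simp
  have hup1 : W.eval 1 ≤ 10 * n := by
    have hd (x : ℝ) (hx : 0 < x) :
        HasDerivAt (fun x => W.eval x + 2 * x⁻¹) ((derivative W).eval x + 2 * -(x ^ 2)⁻¹) x :=
      (W.hasDerivAt x).add ((hasDerivAt_inv hx.ne').const_mul 2)
    have hanti : AntitoneOn (fun x => W.eval x + 2 * x⁻¹) (Set.Icc (1 / n) 1) := by
      refine antitoneOn_of_deriv_nonpos (convex_Icc _ _)
        (fun x hx => (hd x (hni0.trans_le hx.1)).continuousAt.continuousWithinAt)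
        (fun x hx => ?_) fun x hx => ?_
      · rw [interior_Icc] at hx
        exact (hd x (hni0.trans hx.1)).differentiableAt.differentiableWithinAt
      · rw [interior_Icc] at hx
        have hx' : x ∈ Set.Ioc (0 : ℝ) 1 := ⟨hni0.trans hx.1, hx.2.le⟩
        rw [(hd x hx'.1).deriv, ← Polynomial.deriv, hderiv' x hx']
        have := (hK x hx').2.1
        rw [one_div] at this
        linarith
    have := hanti ⟨le_rfl, hni⟩ ⟨hni, le_rfl⟩ hni
    simp only [one_div, inv_inv, inv_one] at this hup
    linarith
  refine ⟨C (1 / 2) + C (1 / (20 * n)) * W, ?_, fun x hx => ?_⟩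
  · refine (natDegree_add_le _ _).trans (max_le (by simp) ((natDegree_C_mul_le _ _).trans ?_))
    refine (natDegree_sub_le _ _).trans (max_le (by omega) (natDegree_comp_le.trans ?_))
    rw [natDegree_neg, natDegree_X]
    omega
  · have hV : (C (1 / 2) + C (1 / (20 * n)) * W).eval x = 1 / 2 + W.eval x / (20 * n) := by
      simp only [eval_add, eval_mul, eval_C]; ring
    have h1 : W.eval x ≤ 10 * n := (hmono hx.2).trans hup1
    have h2 : -(10 * n) ≤ W.eval x := by
      have := hmono hx.1
      simp only [hWneg] at this
      linarith
    rw [hV]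
    have hpos : 0 < 20 * n := by positivity
    refine ⟨⟨?_, ?_⟩, fun h => ?_, fun h => ?_⟩
    · have : -(1 / 2) ≤ W.eval x / (20 * n) := by rw [le_div_iff₀ hpos]; linarith
      linarith
    · have : W.eval x / (20 * n) ≤ 1 / 2 := by rw [div_le_iff₀ hpos]; linarith
      linarith
    · have h3 := hlow.trans (hmono h)
      have : 1 / 40 ≤ W.eval x / (20 * n) := by rw [le_div_iff₀ hpos]; linarith
      linarith
    · have h3 := hmono h
      simp only [hWneg] at h3
      have : W.eval x / (20 * n) ≤ -(1 / 40) := by rw [div_le_iff₀ hpos]; linarith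
      linarith

/-- A polynomial step of degree `O(log (1 / ε) / δ)`. -/
theorem exists_step {δ ε : ℝ} (hδ : δ ∈ Set.Ioc (0 : ℝ) (1 / 2)) (hε : ε ∈ Set.Ioc (0 : ℝ) (1 / 2)) :
    ∃ S : ℝ[X], (S.natDegree : ℝ) ≤ 12000 * Real.log (1 / ε) / δ ∧
      (∀ x ∈ Set.Icc (-1 : ℝ) 1, S.eval x ∈ Set.Icc (0 : ℝ) 1) ∧
      (∀ x ∈ Set.Icc δ 1, 1 - ε ≤ S.eval x) ∧ ∀ x ∈ Set.Icc (-1 : ℝ) 0, S.eval x ≤ ε := by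
  obtain ⟨hδ0, hδ1⟩ := hδ
  set L := Real.log (1 / ε) with hL
  have hL2 : 1 / 2 ≤ L := half_le_log_one_div hε
  have hexp : Real.exp (-L) = ε := exp_neg_log_one_div hε.1
  set N := ⌈800 * L⌉₊ with hN
  set j := ⌈1 / δ⌉₊ with hj
  have hj1 : 1 / δ ≤ j := Nat.le_ceil _
  have hj2 : (j : ℝ) ≤ 1 / δ + 1 := (Nat.ceil_lt_add_one (by positivity)).le
  have hN1 : 800 * L ≤ N := Nat.le_ceil _
  have hN2 : (N : ℝ) ≤ 800 * L + 1 := (Nat.ceil_lt_add_one (by positivity)).le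
  have hpow : (799 / 800 : ℝ) ^ N ≤ ε := by
    rw [← hexp]
    calc (799 / 800 : ℝ) ^ N ≤ Real.exp (-(1 / 800)) ^ N := by
          refine pow_le_pow_left₀ (by norm_num) ?_ N
          linarith [Real.add_one_le_exp (-(1 / 800) : ℝ)]
      _ = Real.exp (N * -(1 / 800)) := (Real.exp_nat_mul _ _).symm
      _ ≤ _ := Real.exp_le_exp.mpr (by linarith)
  have hgap : 1 / (4 * j + 1 : ℝ) ≤ δ / 4 := by
    rw [div_le_iff₀ (by positivity)]
    rw [div_le_iff₀ hδ0] at hj1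
    nlinarith
  obtain ⟨A, hAd, hA⟩ := exists_amplifier N
  obtain ⟨V, hVd, hV⟩ := exists_crude_step j
  have hev (x : ℝ) : (A.comp (V.comp (C (1 / 2) * (X - C (δ / 2))))).eval x =
      A.eval (V.eval ((x - δ / 2) / 2)) := by
    simp only [eval_comp, eval_mul, eval_sub, eval_C, eval_X]
    rw [show 1 / 2 * (x - δ / 2) = (x - δ / 2) / 2 by ring]
  have hmem (x : ℝ) (hx : x ∈ Set.Icc (-1 : ℝ) 1) : (x - δ / 2) / 2 ∈ Set.Icc (-1 : ℝ) 1 :=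
    ⟨by linarith [hx.1], by linarith [hx.2]⟩
  refine ⟨A.comp (V.comp (C (1 / 2) * (X - C (δ / 2)))), ?_, fun x hx => ?_, fun x hx => ?_,
    fun x hx => ?_⟩
  · have hd : (A.comp (V.comp (C (1 / 2) * (X - C (δ / 2))))).natDegree ≤ N * (8 * j + 1) := by
      refine natDegree_comp_le.trans (Nat.mul_le_mul hAd (natDegree_comp_le.trans ?_))
      refine (Nat.mul_le_mul hVd ((natDegree_C_mul_le _ _).trans (natDegree_X_sub_C_le _))).trans ?_
      rw [mul_one]
    calc _ ≤ (N : ℝ) * (8 * j + 1) := by exact_mod_cast hd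
      _ ≤ (802 * L) * (13 / δ) := by
        have h2 : 2 ≤ 1 / δ := by rw [le_div_iff₀ hδ0]; linarith
        have h3 : 13 / δ = 13 * (1 / δ) := by ring
        gcongr
        · linarith
        · rw [h3]; linarith
      _ = 10426 * L / δ := by ring
      _ ≤ _ := by gcongr; norm_num
  · rw [hev]
    have h := hA _ (hV _ (hmem x hx)).1
    exact ⟨h.1, h.2.1⟩
  · have hx' := hmem x ⟨by linarith [hx.1], hx.2⟩
    have h := hA _ (hV _ hx').1
    rw [hev]
    linarith [h.2.2.2 ((hV _ hx').2.1 (by linarith [hx.1]))]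
  · have hx' := hmem x ⟨hx.1, by linarith [hx.2]⟩
    have h := hA _ (hV _ hx').1
    rw [hev]
    linarith [h.2.2.1 ((hV _ hx').2.2 (by linarith [hx.2]))]

theorem three_quarters_le_rpow {c : ℝ} (hc : 0 < c) :
    3 / 4 ≤ (1 - 1 / (4 * max 1 c)) ^ c := by
  rcases le_total 1 c with h | h
  · rw [max_eq_right h, sub_eq_add_neg]
    refine le_trans (le_of_eq ?_) (one_add_mul_self_le_rpow_one_add ?_ h)
    · field_simp; norm_num
    · rw [neg_le_neg_iff, div_le_one (by positivity)]; linarith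
  · rw [max_eq_left h]
    calc (3 / 4 : ℝ) = (1 - 1 / (4 * 1)) ^ (1 : ℝ) := by rw [Real.rpow_one]; norm_num
      _ ≤ _ := Real.rpow_le_rpow_of_exponent_ge (by norm_num) (by norm_num) h

theorem log_eight_div_le {ε : ℝ} (hε : ε ∈ Set.Ioc (0 : ℝ) (1 / 2)) :
    Real.log (1 / (ε / 8)) ≤ 4 * Real.log (1 / ε) := by
  have hε0 := hε.1
  have h1 : Real.log 2 ≤ Real.log (1 / ε) :=
    Real.log_le_log (by norm_num) (by rw [le_div_iff₀ hε0]; linarith [hε.2])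
  rw [show 1 / (ε / 8) = 2 ^ 3 * (1 / ε) by field_simp; norm_num,
    Real.log_mul (by norm_num) (by positivity), Real.log_pow]
  push_cast
  linarith

/-- A polynomial close to `x ^ (-c)` (suitably normalised) on `[δ, 1]` and bounded on `[-1, 1]`,
without parity requirement. -/
theorem exists_bounded_approx {δ ε c : ℝ} (hδ : δ ∈ Set.Ioc (0 : ℝ) (1 / 2))
    (hε : ε ∈ Set.Ioc (0 : ℝ) (1 / 16)) (hc : 0 < c) :
    ∃ G : ℝ[X], (G.natDegree : ℝ) ≤ 64 * Real.log (1 / ε) * (max 1 c / δ) + 2 ∧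
      (∀ x ∈ Set.Icc (-1 : ℝ) 1, |G.eval x| ≤ 3 / 4) ∧
      ∀ x ∈ Set.Icc δ 1, |G.eval x - δ ^ c / 2 * x ^ (-c)| ≤ 2 * ε := by
  obtain ⟨hδ0, hδ1⟩ := hδ
  obtain ⟨hε0, hε1⟩ := hε
  have hpow := three_quarters_le_rpow hc
  set M := max 1 c with hM
  have hM1 : 1 ≤ M := le_max_left _ _
  set η := 1 / (4 * M) with hη
  have hη0 : 0 < η := by positivity
  have hη1 : η ≤ 1 / 4 := by
    rw [hη, div_le_div_iff₀ (by positivity) (by norm_num)]; linarith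
  set a := δ * (1 - η) with ha
  have ha0 : 0 < a := mul_pos hδ0 (by linarith)
  have haδ : a = δ - η * δ := by rw [ha]; ring
  have ha1 : a ≤ 1 := by nlinarith
  set γ := η * δ / 2 with hγ
  have hγ0 : 0 < γ := by positivity
  have hγ1 : γ ≤ 1 := by nlinarith
  have hβ : δ ^ c / 2 * a ^ (-c) ≤ 2 / 3 := by
    rw [ha, Real.mul_rpow hδ0.le (by linarith), Real.rpow_neg hδ0.le,
      Real.rpow_neg (by linarith : (0 : ℝ) ≤ 1 - η)]
    have h1 : 0 < δ ^ c := Real.rpow_pos_of_pos hδ0 c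
    have h2 : 0 < (1 - η) ^ c := by linarith
    calc δ ^ c / 2 * ((δ ^ c)⁻¹ * ((1 - η) ^ c)⁻¹) = 1 / (2 * (1 - η) ^ c) := by field_simp
      _ ≤ _ := by rw [div_le_div_iff₀ (by positivity) (by norm_num)]; linarith
  have hδc : 0 ≤ δ ^ c / 2 := by positivity
  have hB0 : 0 ≤ a ^ (-c) := by positivity
  obtain ⟨b, hb, hsum⟩ := exists_hasSum_add_sqrt_rpow_neg ha0 hc
  obtain ⟨p, hpd, hp1, hp2⟩ := exists_approx_of_nonneg_series hb hsum (B := a ^ (-c))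
    (fun q _ => Real.rpow_le_rpow_of_nonpos ha0 (by linarith [Real.sqrt_nonneg (1 - q)])
      (by linarith)) ⟨hγ0, hγ1⟩ (ε := ε) ⟨hε0, by linarith⟩
  set Q : ℝ[X] := 1 - C (1 / 4) * (X - C a) ^ 2 with hQ
  have hQe (x : ℝ) : Q.eval x = 1 - ((x - a) / 2) ^ 2 := by
    simp only [hQ, eval_sub, eval_one, eval_mul, eval_C, eval_pow, eval_X]; ring
  have hQd : Q.natDegree ≤ 2 := by
    refine (natDegree_sub_le _ _).trans (max_le (by simp) ((natDegree_C_mul_le _ _).trans ?_))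
    exact natDegree_pow_le_of_le 2 (natDegree_X_sub_C_le a)
  have hGe (x : ℝ) : (C (δ ^ c / 2) * p.comp Q).eval x =
      δ ^ c / 2 * p.eval (1 - ((x - a) / 2) ^ 2) := by
    rw [eval_mul, eval_C, eval_comp, hQe]
  refine ⟨C (δ ^ c / 2) * p.comp Q, ?_, fun x hx => ?_, fun x hx => ?_⟩
  · have hd : (C (δ ^ c / 2) * p.comp Q).natDegree ≤ p.natDegree * 2 :=
      (natDegree_C_mul_le _ _).trans (natDegree_comp_le.trans (Nat.mul_le_mul_left _ hQd))
    calc ((C (δ ^ c / 2) * p.comp Q).natDegree : ℝ) ≤ p.natDegree * 2 := by exact_mod_cast hd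
      _ ≤ (4 * Real.log (1 / ε) / γ + 1) * 2 := by gcongr
      _ = _ := by rw [hγ, hη]; field_simp; ring
  · obtain ⟨hx1, hx2⟩ := hx
    rw [hGe, abs_mul, abs_of_nonneg hδc]
    have hsq : ((x - a) / 2) ^ 2 ≤ 1 := by
      rw [sq_le_one_iff_abs_le_one, abs_le]; constructor <;> linarith
    calc _ ≤ δ ^ c / 2 * (a ^ (-c) + 2 * a ^ (-c) * ε) := by
          gcongr
          exact hp1 _ ⟨by linarith, by linarith [sq_nonneg ((x - a) / 2)]⟩
      _ = δ ^ c / 2 * a ^ (-c) * (1 + 2 * ε) := by ring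
      _ ≤ 2 / 3 * (1 + 2 * (1 / 16)) := by gcongr
      _ = 3 / 4 := by norm_num
  · obtain ⟨hx1, hx2⟩ := hx
    have hxa : γ ≤ (x - a) / 2 := by rw [hγ]; linarith
    have hf : a + 2 * √(1 - (1 - ((x - a) / 2) ^ 2)) = x := by
      rw [sub_sub_cancel, Real.sqrt_sq (hγ0.le.trans hxa)]; ring
    have h := hp2 (1 - ((x - a) / 2) ^ 2) ⟨by nlinarith, by gcongr⟩
    rw [hf] at h
    rw [hGe, ← mul_sub, abs_mul, abs_of_nonneg hδc]
    calc _ ≤ δ ^ c / 2 * (3 * a ^ (-c) * ε) := by gcongr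
      _ = 3 * (δ ^ c / 2 * a ^ (-c)) * ε := by ring
      _ ≤ 3 * (2 / 3) * ε := by gcongr
      _ = _ := by ring

theorem coeff_comp_neg_X (p : ℝ[X]) (k : ℕ) : (p.comp (-X)).coeff k = (-1) ^ k * p.coeff k := by
  rw [show (-X : ℝ[X]) = C (-1) * X by simp, comp_C_mul_X_coeff, mul_comm]

theorem even_of_mem_support_add_comp_neg_X {H : ℝ[X]} {k : ℕ}
    (hk : k ∈ (H + H.comp (-X)).support) : Even k := by
  by_contra h
  rw [Nat.not_even_iff_odd] at h
  simp [coeff_comp_neg_X, h.neg_one_pow] at hk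

theorem odd_of_mem_support_sub_comp_neg_X {H : ℝ[X]} {k : ℕ}
    (hk : k ∈ (H - H.comp (-X)).support) : Odd k := by
  by_contra h
  rw [Nat.not_odd_iff_even] at h
  simp [coeff_comp_neg_X, h.neg_one_pow] at hk

/-- Polynomial approximation of negative power functions: there is a universal constant
`C > 0` such that for all `δ, ε ∈ (0, 1/2]` and `c > 0`, the function
`f(x) = (δ^c/2) x^{−c}` admits an even polynomial `P` and an odd polynomial `P'`, each of
degree at most `C (max(1,c)/δ) log(1/ε)`, that are `ε`-close to `f` on `[δ, 1]` and bounded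
by `1` on `[−1, 1]`. -/
theorem poly_approx_inverse_power :
    ∃ C : ℝ, 0 < C ∧
      ∀ δ ε : ℝ, δ ∈ Set.Ioc (0 : ℝ) (1 / 2) → ε ∈ Set.Ioc (0 : ℝ) (1 / 2) →
      ∀ c : ℝ, 0 < c →
      ∃ P P' : Polynomial ℝ,
        (∀ k ∈ P.support, Even k) ∧ (∀ k ∈ P'.support, Odd k) ∧
        (P.natDegree : ℝ) ≤ C * (max 1 c / δ) * Real.log (1 / ε) ∧
        (P'.natDegree : ℝ) ≤ C * (max 1 c / δ) * Real.log (1 / ε) ∧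
        (∀ x ∈ Set.Icc δ 1, |P.eval x - Real.rpow δ c / 2 * Real.rpow x (-c)| ≤ ε) ∧
        (∀ x ∈ Set.Icc (-1 : ℝ) 1, |P.eval x| ≤ 1) ∧
        (∀ x ∈ Set.Icc δ 1, |P'.eval x - Real.rpow δ c / 2 * Real.rpow x (-c)| ≤ ε) ∧
        (∀ x ∈ Set.Icc (-1 : ℝ) 1, |P'.eval x| ≤ 1) := by
  refine ⟨50000, by norm_num, fun δ ε hδ hε c hc => ?_⟩
  simp only [Real.rpow_eq_pow]
  have hδ0 := hδ.1
  have hε0 := hε.1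
  have hL := half_le_log_one_div hε
  have hL1 := log_eight_div_le hε
  set L := Real.log (1 / ε)
  have hM1 : 1 ≤ max 1 c := le_max_left _ _
  obtain ⟨G, hGd, hG1, hG2⟩ := exists_bounded_approx hδ (ε := ε / 8)
    ⟨by linarith, by linarith [hε.2]⟩ hc
  obtain ⟨S, hSd, hS, hS1, hS0⟩ := exists_step hδ (ε := ε / 8)
    ⟨by linarith, by linarith [hε.2]⟩
  set H := G * S with hH
  have hHe (x : ℝ) : H.eval x = G.eval x * S.eval x := eval_mul
  have hdeg : (H.natDegree : ℝ) ≤ 50000 * (max 1 c / δ) * L := by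
    set R := max 1 c / δ with hR
    have hR1 : 1 / δ ≤ R := by rw [hR]; gcongr
    have hR2 : 2 ≤ R := le_trans (by rw [le_div_iff₀ hδ0]; linarith [hδ.2]) hR1
    have h1 : (H.natDegree : ℝ) ≤ G.natDegree + S.natDegree := by
      exact_mod_cast natDegree_mul_le
    have h2 : 64 * Real.log (1 / (ε / 8)) * R ≤ 64 * (4 * L) * R := by gcongr
    have h3 : 12000 * Real.log (1 / (ε / 8)) / δ ≤ 12000 * (4 * L) * R :=
      calc _ ≤ 12000 * (4 * L) / δ := by gcongr
        _ = 12000 * (4 * L) * (1 / δ) := by ring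
        _ ≤ _ := by gcongr
    nlinarith
  have hHneg : (H.comp (-X)).natDegree = H.natDegree := natDegree_comp.trans (by simp)
  have hpos (x : ℝ) (hx : x ∈ Set.Icc (-1 : ℝ) 1) : |H.eval x| ≤ 3 / 4 := by
    rw [hHe, abs_mul, abs_of_nonneg (hS x hx).1]
    exact (mul_le_mul (hG1 x hx) (hS x hx).2 (hS x hx).1 (by norm_num)).trans (by norm_num)
  have hneg (x : ℝ) (hx : x ∈ Set.Icc (-1 : ℝ) 0) : |H.eval x| ≤ ε / 8 := by
    have hx' : x ∈ Set.Icc (-1 : ℝ) 1 := ⟨hx.1, by linarith [hx.2]⟩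
    rw [hHe, abs_mul, abs_of_nonneg (hS x hx').1]
    refine (mul_le_mul (hG1 x hx') (hS0 x hx) (hS x hx').1 (by norm_num)).trans ?_
    linarith
  have hbd (x : ℝ) (hx : x ∈ Set.Icc (-1 : ℝ) 1) : |H.eval x| + |H.eval (-x)| ≤ 1 := by
    have hx' : -x ∈ Set.Icc (-1 : ℝ) 1 := ⟨by linarith [hx.2], by linarith [hx.1]⟩
    rcases le_total 0 x with h | h
    · linarith [hpos x hx, hneg (-x) ⟨hx'.1, by linarith⟩, hε.2]
    · linarith [hpos (-x) hx', hneg x ⟨hx.1, h⟩, hε.2]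
  have herr (x : ℝ) (hx : x ∈ Set.Icc δ 1) :
      |H.eval x - δ ^ c / 2 * x ^ (-c)| + |H.eval (-x)| ≤ ε := by
    have hx' : x ∈ Set.Icc (-1 : ℝ) 1 := ⟨by linarith [hx.1], hx.2⟩
    have h1 := hneg (-x) ⟨by linarith [hx.2], by linarith [hx.1]⟩
    have h2 : |G.eval x * (1 - S.eval x)| ≤ 3 / 4 * (ε / 8) := by
      have h0 : 0 ≤ 1 - S.eval x := by linarith [(hS x hx').2]
      rw [abs_mul, abs_of_nonneg h0]
      exact mul_le_mul (hG1 x hx') (by linarith [hS1 x hx]) h0 (by norm_num)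
    have h3 : |H.eval x - δ ^ c / 2 * x ^ (-c)| ≤
        |G.eval x - δ ^ c / 2 * x ^ (-c)| + |G.eval x * (1 - S.eval x)| := by
      refine le_trans (le_of_eq ?_) (abs_sub _ _)
      rw [hHe]; congr 1; ring
    linarith [hG2 x hx]
  refine ⟨H + H.comp (-X), H - H.comp (-X), fun k => even_of_mem_support_add_comp_neg_X,
    fun k => odd_of_mem_support_sub_comp_neg_X, le_trans ?_ hdeg, le_trans ?_ hdeg,
    fun x hx => ?_, fun x hx => ?_, fun x hx => ?_, fun x hx => ?_⟩
  · exact_mod_cast (natDegree_add_le _ _).trans (by rw [hHneg, max_self])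
  · exact_mod_cast (natDegree_sub_le _ _).trans (by rw [hHneg, max_self])
  all_goals simp only [eval_add, eval_sub, eval_comp, eval_neg, eval_X]
  · rw [add_sub_right_comm]
    exact (abs_add_le _ _).trans (herr x hx)
  · exact (abs_add_le _ _).trans (hbd x hx)
  · rw [sub_right_comm]
    exact (abs_sub _ _).trans (herr x hx)
  · exact (abs_sub _ _).trans (hbd x hx)
end
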